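/- arXiv:math/0311269 — 3 statements merged into one kernel-verified Lean document; each statement's English description precedes it below -/
import Mathlib

section
/- Assume the relaxed-control exit-time setup with hypotheses (STCT), (H5), (H6). If the value function v is finite and continuous on ℝ^N, then v is a viscosity solution of the HJBE sup_{m ∈ A^r} { −f^r(x,m)·Dw(x) − ℓ^r(x,m) } = 0 on ℝ^N ∖ T, is bounded from below, vanishes on T, and is the unique such function: any continuous w : ℝ^N → ℝ that is a viscosity solution of the HJBE on ℝ^N ∖ T, is bounded from below, and vanishes on T equals v. -/
open MeasureTheory Set Filter Topology Metric
open scoped RealInnerProductSpace ENNReal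

noncomputable section

/-- The set of relaxed controls: measurable families `t ↦ β t` of Radon probability
measures on the control space `A` (measurability in the weak-* sense). -/
def IsRelaxedControl {A : Type*} [MetricSpace A] [MeasurableSpace A]
    (β : ℝ → Measure A) : Prop :=
  (∀ t, IsProbabilityMeasure (β t)) ∧
    ∀ g : C(A, ℝ), Measurable fun t => ∫ a, g a ∂(β t)

/-- `y` is the trajectory of `ẏ = f^r(y, β)` with `y 0 = x` (integral form). -/
def IsTrajectory {N : ℕ} {A : Type*} [MeasurableSpace A]
    (f : EuclideanSpace ℝ (Fin N) → A → EuclideanSpace ℝ (Fin N))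
    (β : ℝ → Measure A) (x : EuclideanSpace ℝ (Fin N))
    (y : ℝ → EuclideanSpace ℝ (Fin N)) : Prop :=
  y 0 = x ∧ Continuous y ∧
    ∀ t, 0 ≤ t → y t = x + ∫ s in (0:ℝ)..t, ∫ a, f (y s) a ∂(β s)

/-- The set of times `t ≥ 0` at which the trajectory `y` lies in the target `T`;
its infimum is the exit time `t_x(β)`, and `t_x(β) < ∞` iff this set is nonempty. -/
def exitTimes {N : ℕ} (T : Set (EuclideanSpace ℝ (Fin N)))
    (y : ℝ → EuclideanSpace ℝ (Fin N)) : Set ℝ :=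
  {t : ℝ | 0 ≤ t ∧ y t ∈ T}

/-- The running cost `∫₀^t ℓ^r(y(s), β(s)) ds`, as an extended nonnegative real. -/
def runCost {N : ℕ} {A : Type*} [MeasurableSpace A]
    (ℓ : EuclideanSpace ℝ (Fin N) → A → ℝ) (β : ℝ → Measure A)
    (y : ℝ → EuclideanSpace ℝ (Fin N)) (t : ℝ) : ℝ≥0∞ :=
  ∫⁻ s in Ioc (0:ℝ) t, ENNReal.ofReal (∫ a, ℓ (y s) a ∂(β s))

/-- The value function `v(x)` of the exit time problem, as an extended real
(`+∞` when no relaxed control brings `x` to the target in finite time). -/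
def valueFn {N : ℕ} {A : Type*} [MetricSpace A] [MeasurableSpace A]
    (T : Set (EuclideanSpace ℝ (Fin N))) (ℓ : EuclideanSpace ℝ (Fin N) → A → ℝ)
    (Y : EuclideanSpace ℝ (Fin N) → (ℝ → Measure A) → ℝ → EuclideanSpace ℝ (Fin N))
    (x : EuclideanSpace ℝ (Fin N)) : EReal :=
  sInf { c : EReal | ∃ β : ℝ → Measure A, IsRelaxedControl β ∧
      (exitTimes T (Y x β)).Nonempty ∧
      c = ((runCost ℓ β (Y x β) (sInf (exitTimes T (Y x β)))) : EReal) }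

/-- Viscosity solution of `F(x, Dw(x)) = 0` on the open set `G`, via `C¹` test functions. -/
def IsViscositySol {N : ℕ}
    (F : EuclideanSpace ℝ (Fin N) → EuclideanSpace ℝ (Fin N) → ℝ)
    (G : Set (EuclideanSpace ℝ (Fin N))) (w : EuclideanSpace ℝ (Fin N) → ℝ) : Prop :=
  (∀ γ : EuclideanSpace ℝ (Fin N) → ℝ, ContDiffOn ℝ 1 γ G → ∀ x₀ ∈ G,
      IsLocalMinOn (fun x => w x - γ x) G x₀ → 0 ≤ F x₀ (gradient γ x₀)) ∧
  (∀ γ : EuclideanSpace ℝ (Fin N) → ℝ, ContDiffOn ℝ 1 γ G → ∀ x₁ ∈ G,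
      IsLocalMaxOn (fun x => w x - γ x) G x₁ → F x₁ (gradient γ x₁) ≤ 0)

/-- The Hamiltonian `sup_{m ∈ A^r} { −f^r(x,m)·p − ℓ^r(x,m) }` of the HJBE. -/
def HJB {N : ℕ} {A : Type*} [MetricSpace A] [MeasurableSpace A]
    (f : EuclideanSpace ℝ (Fin N) → A → EuclideanSpace ℝ (Fin N))
    (ℓ : EuclideanSpace ℝ (Fin N) → A → ℝ)
    (x p : EuclideanSpace ℝ (Fin N)) : ℝ :=
  ⨆ m : ProbabilityMeasure A,
    (-(inner (𝕜 := ℝ) (∫ a, f x a ∂(m : Measure A)) p : ℝ) - ∫ a, ℓ x a ∂(m : Measure A))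


namespace ExitTime

section Basics

set_option linter.unusedSectionVars false

variable {N : ℕ} {A : Type*} [MetricSpace A] [CompactSpace A]
    [MeasurableSpace A] [BorelSpace A]
variable {E' : Type*} [NormedAddCommGroup E'] [NormedSpace ℝ E'] [SecondCountableTopology E']

theorem relaxed_measurable {β : ℝ → Measure A} (hβ : IsRelaxedControl β) : Measurable β := by
  have := hβ.1
  refine Measurable.measure_of_isPiSystem_of_isProbabilityMeasure
    (BorelSpace.measurable_eq.trans borel_eq_generateFrom_isClosed) isPiSystem_isClosed ?_
  intro F hF
  have hpos : ∀ n : ℕ, (0:ℝ) < 1 / ((n:ℝ) + 1) := fun n => Nat.one_div_pos_of_nat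
  have hlim := tendsto_one_div_add_atTop_nhds_zero_nat (𝕜 := ℝ)
  have h1 : Measurable fun t => (β t).real F := by
    refine measurable_of_tendsto_metrizable (f := fun (n : ℕ) t =>
      ∫ a, (thickenedIndicator (hpos n) F a : ℝ) ∂(β t)) (fun n => ?_) ?_
    · exact hβ.2 ⟨fun a => (thickenedIndicator (hpos n) F a : ℝ), by fun_prop⟩
    · rw [tendsto_pi_nhds]
      intro t
      exact tendsto_integral_thickenedIndicator_of_isClosed (β t) hF hpos hlim
  have h2 : (fun t => β t F) = fun t => ENNReal.ofReal ((β t).real F) := by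
    funext t; simp
  rw [h2]
  exact h1.ennreal_ofReal

/-- relaxed control as a Markov kernel -/
def ker {β : ℝ → Measure A} (hβ : IsRelaxedControl β) : ProbabilityTheory.Kernel ℝ A :=
  ⟨β, relaxed_measurable hβ⟩

instance {β : ℝ → Measure A} (hβ : IsRelaxedControl β) :
    ProbabilityTheory.IsMarkovKernel (ker hβ) := ⟨fun t => hβ.1 t⟩

theorem relaxed_sm {β : ℝ → Measure A} (hβ : IsRelaxedControl β) {φ : ℝ × A → E'}
    (hφ : Continuous φ) : StronglyMeasurable fun s => ∫ a, φ (s, a) ∂(β s) := by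
  have : StronglyMeasurable φ := hφ.stronglyMeasurable
  exact this.integral_kernel_prod_right' (κ := ker hβ)

theorem cont_integrable (m : Measure A) [IsFiniteMeasure m] {φ : A → E'}
    (hφ : Continuous φ) : Integrable φ m :=
  hφ.integrable_of_hasCompactSupport (HasCompactSupport.of_compactSpace φ)

theorem relaxed_ii {β : ℝ → Measure A} (hβ : IsRelaxedControl β) {φ : ℝ × A → E'}
    (hφ : Continuous φ) (s t : ℝ) :
    IntervalIntegrable (fun s => ∫ a, φ (s, a) ∂(β s)) volume s t := by
  have hK : IsCompact ((uIcc s t) ×ˢ (univ : Set A)) := isCompact_uIcc.prod isCompact_univ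
  obtain ⟨C, hC⟩ := hK.exists_bound_of_continuousOn hφ.continuousOn
  rw [intervalIntegrable_iff]
  apply Measure.integrableOn_of_bounded (M := C) (by simp)
    (relaxed_sm hβ hφ).aestronglyMeasurable
  rw [ae_restrict_iff' measurableSet_uIoc]
  filter_upwards with r hr
  have := hβ.1 r
  calc ‖∫ a, φ (r, a) ∂(β r)‖ ≤ C * (β r).real univ :=
        norm_integral_le_of_norm_le_const (by
          filter_upwards with a
          exact hC (r, a) ⟨uIoc_subset_uIcc hr, mem_univ _⟩)
    _ = C := by simp

end Basics
end ExitTime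

namespace ExitTime

theorem gronwall_int {u : ℝ → ℝ} (hu : Continuous u) {c L t₀ : ℝ} (hL : 0 ≤ L)
    (h : ∀ t ∈ Icc 0 t₀, u t ≤ c + L * ∫ s in (0:ℝ)..t, u s) :
    ∀ t ∈ Icc 0 t₀, u t ≤ c * Real.exp (L * t) := by
  set U : ℝ → ℝ := fun t => ∫ s in (0:ℝ)..t, u s with hU
  have hUd : ∀ t, HasDerivAt U (u t) t := fun t =>
    intervalIntegral.integral_hasDerivAt_right (hu.intervalIntegrable _ _)
      hu.stronglyMeasurable.stronglyMeasurableAtFilter hu.continuousAt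
  set g : ℝ → ℝ := fun t => (c + L * U t) * Real.exp (-L * t) with hg
  have hgd : ∀ t, HasDerivAt g (L * (u t - (c + L * U t)) * Real.exp (-L * t)) t := by
    intro t
    have h1 : HasDerivAt (fun t => c + L * U t) (L * u t) t := ((hUd t).const_mul L).const_add c
    have h2 : HasDerivAt (fun t => Real.exp (-L * t)) (Real.exp (-L * t) * (-L)) t := by
      simpa using ((hasDerivAt_id t).const_mul (-L)).exp
    refine (h1.mul h2).congr_deriv ?_
    ring
  have hanti : AntitoneOn g (Icc 0 t₀) := by
    apply antitoneOn_of_deriv_nonpos (convex_Icc _ _)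
    · exact fun t _ => (hgd t).continuousAt.continuousWithinAt
    · exact fun t _ => (hgd t).differentiableAt.differentiableWithinAt
    · intro t ht
      rw [interior_Icc] at ht
      rw [(hgd t).deriv]
      have := h t (Ioo_subset_Icc_self ht)
      have h3 : L * (u t - (c + L * U t)) ≤ 0 :=
        mul_nonpos_of_nonneg_of_nonpos hL (by linarith)
      exact mul_nonpos_of_nonpos_of_nonneg h3 (Real.exp_pos _).le
  intro t ht
  have h0 := hanti (left_mem_Icc.2 (ht.1.trans ht.2)) ht ht.1
  have h4 : g 0 = c := by simp [hg, hU]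
  rw [h4] at h0
  have h5 : c + L * U t = g t * Real.exp (L * t) := by
    simp only [hg]
    rw [mul_assoc, ← Real.exp_add]
    simp
  calc u t ≤ c + L * U t := h t ht
    _ = g t * Real.exp (L * t) := h5
    _ ≤ c * Real.exp (L * t) := by gcongr

/-- shorthand for the state space -/
abbrev Eu (N : ℕ) := EuclideanSpace ℝ (Fin N)

section Traj

set_option linter.unusedSectionVars false

variable {N : ℕ} {A : Type*} [MetricSpace A] [CompactSpace A]
    [MeasurableSpace A] [BorelSpace A]

theorem cont_comp {E' : Type*} [TopologicalSpace E'] {g : Eu N → A → E'}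
    (hg : Continuous fun q : Eu N × A => g q.1 q.2) {y : ℝ → Eu N} (hy : Continuous y) :
    Continuous fun q : ℝ × A => g (y q.1) q.2 :=
  hg.comp ((hy.comp continuous_fst).prodMk continuous_snd)

theorem cont_slice {E' : Type*} [TopologicalSpace E'] {g : Eu N → A → E'}
    (hg : Continuous fun q : Eu N × A => g q.1 q.2) (x : Eu N) : Continuous (g x) :=
  hg.comp (continuous_const.prodMk continuous_id)

theorem rel_ii {E' : Type*} [NormedAddCommGroup E'] [NormedSpace ℝ E']
    [SecondCountableTopology E'] {g : Eu N → A → E'}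
    (hg : Continuous fun q : Eu N × A => g q.1 q.2) {β : ℝ → Measure A} (hβ : IsRelaxedControl β)
    {y : ℝ → Eu N} (hy : Continuous y) (s t : ℝ) :
    IntervalIntegrable (fun s => ∫ a, g (y s) a ∂(β s)) volume s t :=
  relaxed_ii hβ (φ := fun q => g (y q.1) q.2) (cont_comp hg hy) s t

theorem rel_lip {f : Eu N → A → Eu N} (hf : Continuous fun q : Eu N × A => f q.1 q.2) {L : ℝ}
    (hfLip : ∀ x y a, ‖f x a - f y a‖ ≤ L * ‖x - y‖) (m : Measure A) [IsProbabilityMeasure m]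
    (x y : Eu N) : ‖(∫ a, f x a ∂m) - ∫ a, f y a ∂m‖ ≤ L * ‖x - y‖ := by
  rw [← integral_sub (cont_integrable m (cont_slice hf x)) (cont_integrable m (cont_slice hf y))]
  refine (norm_integral_le_of_norm_le_const (C := L * ‖x - y‖) ?_).trans (by simp)
  filter_upwards with a using hfLip x y a

theorem rel_bound {E' : Type*} [NormedAddCommGroup E'] [NormedSpace ℝ E'] (m : Measure A)
    [IsProbabilityMeasure m] {g : A → E'} {C : ℝ} (h : ∀ a, ‖g a‖ ≤ C) : ‖∫ a, g a ∂m‖ ≤ C := by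
  refine (norm_integral_le_of_norm_le_const (C := C) ?_).trans (by simp)
  filter_upwards with a using h a

theorem traj_unique {f : Eu N → A → Eu N} (hf : Continuous fun q : Eu N × A => f q.1 q.2) {L : ℝ}
    (hL : 0 < L) (hfLip : ∀ x y a, ‖f x a - f y a‖ ≤ L * ‖x - y‖)
    {β β' : ℝ → Measure A} (hβ : IsRelaxedControl β) (hβ' : IsRelaxedControl β')
    {y y' : ℝ → Eu N} (hy : Continuous y) (hy' : Continuous y') {x : Eu N} {t₀ : ℝ}
    (h : ∀ t ∈ Icc 0 t₀, y t = x + ∫ s in (0:ℝ)..t, ∫ a, f (y s) a ∂(β s))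
    (h' : ∀ t ∈ Icc 0 t₀, y' t = x + ∫ s in (0:ℝ)..t, ∫ a, f (y' s) a ∂(β' s))
    (hb : ∀ t ∈ Ioc 0 t₀, β t = β' t) : ∀ t ∈ Icc 0 t₀, y t = y' t := by
  have hu : Continuous fun t => ‖y t - y' t‖ := (hy.sub hy').norm
  have key := gronwall_int hu (c := 0) (L := L) (t₀ := t₀) hL.le ?_
  · intro t ht
    have := key t ht
    rw [zero_mul] at this
    exact sub_eq_zero.1 (norm_le_zero_iff.1 this)
  · intro t ht
    rw [h t ht, h' t ht]
    have e : ∫ s in (0:ℝ)..t, ∫ a, f (y' s) a ∂(β' s) = ∫ s in (0:ℝ)..t, ∫ a, f (y' s) a ∂(β s) := by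
      apply intervalIntegral.integral_congr_ae
      filter_upwards with s hs
      rw [uIoc_of_le ht.1] at hs
      rw [hb s ⟨hs.1, hs.2.trans ht.2⟩]
    rw [e, add_sub_add_left_eq_sub, ← intervalIntegral.integral_sub (rel_ii hf hβ hy _ _)
      (rel_ii hf hβ hy' _ _), zero_add, ← intervalIntegral.integral_const_mul]
    refine intervalIntegral.norm_integral_le_of_norm_le ht.1 ?_ ((hu.const_mul L).intervalIntegrable _ _)
    filter_upwards with s hs
    have := hβ.1 s
    exact rel_lip hf hfLip (β s) _ _

/-- shifted control -/
def shift (t : ℝ) (β : ℝ → Measure A) : ℝ → Measure A := fun s => β (t + s)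

theorem shift_relaxed {β : ℝ → Measure A} (hβ : IsRelaxedControl β) (t : ℝ) :
    IsRelaxedControl (shift t β) :=
  ⟨fun s => hβ.1 _, fun g => (hβ.2 g).comp (measurable_const_add t)⟩

/-- concatenated control -/
def concat (t : ℝ) (β β' : ℝ → Measure A) : ℝ → Measure A :=
  fun s => if s ≤ t then β s else β' (s - t)

theorem concat_relaxed {β β' : ℝ → Measure A} (hβ : IsRelaxedControl β)
    (hβ' : IsRelaxedControl β') (t : ℝ) : IsRelaxedControl (concat t β β') := by
  constructor
  · intro s
    unfold concat
    split_ifs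
    exacts [hβ.1 _, hβ'.1 _]
  · intro g
    have : (fun s => ∫ a, g a ∂(concat t β β' s)) =
        fun s => if s ≤ t then ∫ a, g a ∂(β s) else ∫ a, g a ∂(β' (s - t)) := by
      funext s
      unfold concat
      split_ifs <;> rfl
    rw [this]
    exact Measurable.ite measurableSet_Iic (hβ.2 g) ((hβ'.2 g).comp (measurable_sub_const t))

theorem const_relaxed (m : Measure A) [hm : IsProbabilityMeasure m] :
    IsRelaxedControl (fun _ : ℝ => m) := ⟨fun _ => hm, fun _ => measurable_const⟩

/-- standing hypotheses on the dynamics -/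
structure Dyn (f : Eu N → A → Eu N) (L : ℝ) (Y : Eu N → (ℝ → Measure A) → ℝ → Eu N) : Prop where
  hf : Continuous fun q : Eu N × A => f q.1 q.2
  hL : 0 < L
  hfLip : ∀ x y a, ‖f x a - f y a‖ ≤ L * ‖x - y‖
  hY : ∀ x β, IsRelaxedControl β → IsTrajectory f β x (Y x β)

variable {f : Eu N → A → Eu N} {L : ℝ} {Y : Eu N → (ℝ → Measure A) → ℝ → Eu N}

theorem Y_congr (D : Dyn f L Y) {β β' : ℝ → Measure A} (hβ : IsRelaxedControl β) (hβ' : IsRelaxedControl β')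
    (x : Eu N) {t₀ : ℝ} (hb : ∀ t ∈ Ioc 0 t₀, β t = β' t) : ∀ t ∈ Icc 0 t₀, Y x β t = Y x β' t :=
  traj_unique D.hf D.hL D.hfLip hβ hβ' (D.hY x β hβ).2.1 (D.hY x β' hβ').2.1
    (fun t ht => (D.hY x β hβ).2.2 t ht.1) (fun t ht => (D.hY x β' hβ').2.2 t ht.1) hb

theorem Y_shift (D : Dyn f L Y) {β : ℝ → Measure A} (hβ : IsRelaxedControl β) (x : Eu N) {t s : ℝ} (ht : 0 ≤ t)
    (hs : 0 ≤ s) : Y x β (t + s) = Y (Y x β t) (shift t β) s := by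
  have hs' := shift_relaxed hβ t
  have hc := (D.hY x β hβ).2.1
  refine traj_unique D.hf D.hL D.hfLip (y := fun s => Y x β (t + s)) (t₀ := s) (x := Y x β t) hs' hs'
    (hc.comp (continuous_const.add continuous_id)) (D.hY _ _ hs').2.1 ?_
    (fun r hr => (D.hY _ _ hs').2.2 r hr.1) (fun _ _ => rfl) s ⟨hs, le_rfl⟩
  intro r hr
  have e : ∫ s in (0:ℝ)..r, ∫ a, f (Y x β (t + s)) a ∂(shift t β s) =
      ∫ s in t..(t+r), ∫ a, f (Y x β s) a ∂(β s) := by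
    have := intervalIntegral.integral_comp_add_left (a := 0) (b := r)
      (fun s => ∫ a, f (Y x β s) a ∂(β s)) t
    simpa [shift] using this
  rw [e, (D.hY x β hβ).2.2 t ht, (D.hY x β hβ).2.2 (t + r) (add_nonneg ht hr.1), add_assoc,
    intervalIntegral.integral_add_adjacent_intervals (rel_ii D.hf hβ hc _ _) (rel_ii D.hf hβ hc _ _)]

theorem Y_concat_left (D : Dyn f L Y) {β β' : ℝ → Measure A} (hβ : IsRelaxedControl β)
    (hβ' : IsRelaxedControl β') (x : Eu N) {t s : ℝ} (hs : s ∈ Icc 0 t) :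
    Y x (concat t β β') s = Y x β s :=
  Y_congr D (concat_relaxed hβ hβ' t) hβ x (t₀ := t)
    (fun r hr => by simp [concat, hr.2]) s hs

theorem Y_concat_right (D : Dyn f L Y) {β β' : ℝ → Measure A} (hβ : IsRelaxedControl β)
    (hβ' : IsRelaxedControl β') (x : Eu N) {t s : ℝ} (ht : 0 ≤ t) (hs : 0 ≤ s) :
    Y x (concat t β β') (t + s) = Y (Y x β t) β' s := by
  have hc := concat_relaxed hβ hβ' t
  rw [Y_shift D hc x ht hs,
    Y_concat_left D hβ hβ' x (right_mem_Icc.2 ht)]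
  refine Y_congr D (shift_relaxed hc t) hβ' _ (t₀ := s) ?_ s ⟨hs, le_rfl⟩
  intro r hr
  simp [shift, concat, hr.1]

theorem Y_growth (D : Dyn f L Y) {β : ℝ → Measure A} (hβ : IsRelaxedControl β) (x : Eu N) {C : ℝ}
    (hC : ∀ a, ‖f x a‖ ≤ C) {t : ℝ} (ht : 0 ≤ t) :
    ‖Y x β t - x‖ ≤ C * t * Real.exp (L * t) := by
  have hc := (D.hY x β hβ).2.1
  have hu : Continuous fun t => ‖Y x β t - x‖ := (hc.sub continuous_const).norm
  have hC0 : 0 ≤ C := by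
    obtain ⟨a⟩ : Nonempty A := by
      have := hβ.1 0
      exact nonempty_of_isProbabilityMeasure (β 0)
    exact (norm_nonneg _).trans (hC a)
  refine gronwall_int hu (c := C * t) D.hL.le ?_ t (right_mem_Icc.2 ht)
  intro r hr
  rw [(D.hY x β hβ).2.2 r hr.1, add_sub_cancel_left, ← intervalIntegral.integral_const_mul]
  have h1 : ‖∫ s in (0:ℝ)..r, ∫ a, f (Y x β s) a ∂(β s)‖ ≤
      ∫ s in (0:ℝ)..r, (C + L * ‖Y x β s - x‖) := by
    refine intervalIntegral.norm_integral_le_of_norm_le hr.1 ?_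
      ((continuous_const.add (hu.const_mul L)).intervalIntegrable _ _)
    filter_upwards with s hs
    have := hβ.1 s
    refine rel_bound (β s) fun a => ?_
    calc ‖f (Y x β s) a‖ = ‖f x a + (f (Y x β s) a - f x a)‖ := by congr 1; abel
      _ ≤ ‖f x a‖ + ‖f (Y x β s) a - f x a‖ := norm_add_le _ _
      _ ≤ _ := add_le_add (hC a) (D.hfLip _ _ _)
  refine h1.trans ?_
  rw [intervalIntegral.integral_add (by simp) ((hu.const_mul L).intervalIntegrable _ _),
    intervalIntegral.integral_const]
  simp only [sub_zero, smul_eq_mul]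
  have : r * C ≤ C * t := by rw [mul_comm]; gcongr; exact hr.2
  linarith

end Traj
end ExitTime

namespace ExitTime

section CostSec

set_option linter.unusedSectionVars false

variable {N : ℕ} {A : Type*} [MetricSpace A] [CompactSpace A]
    [MeasurableSpace A] [BorelSpace A]
variable {f : Eu N → A → Eu N} {L : ℝ} {Y : Eu N → (ℝ → Measure A) → ℝ → Eu N}

/-- real-valued running cost -/
def J (ℓ : Eu N → A → ℝ) (Y : Eu N → (ℝ → Measure A) → ℝ → Eu N) (x : Eu N)
    (β : ℝ → Measure A) (t : ℝ) : ℝ :=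
  ∫ s in (0:ℝ)..t, ∫ a, ℓ (Y x β s) a ∂(β s)

/-- standing hypotheses on dynamics and cost -/
structure Setup (f : Eu N → A → Eu N) (L : ℝ) (Y : Eu N → (ℝ → Measure A) → ℝ → Eu N)
    (ℓ : Eu N → A → ℝ) : Prop extends Dyn f L Y where
  hℓ : Continuous fun q : Eu N × A => ℓ q.1 q.2
  hℓnn : ∀ x a, 0 ≤ ℓ x a

variable {ℓ : Eu N → A → ℝ}

theorem Setup.Yc (D : Setup f L Y ℓ) {β : ℝ → Measure A} (hβ : IsRelaxedControl β) (x : Eu N) :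
    Continuous (Y x β) := (D.hY x β hβ).2.1

theorem Setup.Y0 (D : Setup f L Y ℓ) {β : ℝ → Measure A} (hβ : IsRelaxedControl β) (x : Eu N) :
    Y x β 0 = x := (D.hY x β hβ).1

theorem J_ii (D : Setup f L Y ℓ) {β : ℝ → Measure A} (hβ : IsRelaxedControl β) (x : Eu N)
    (s t : ℝ) : IntervalIntegrable (fun s => ∫ a, ℓ (Y x β s) a ∂(β s)) volume s t :=
  rel_ii D.hℓ hβ (D.Yc hβ x) s t

theorem relℓ_nonneg (D : Setup f L Y ℓ) (m : Measure A) (x : Eu N) : 0 ≤ ∫ a, ℓ x a ∂m :=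
  integral_nonneg (D.hℓnn x)

theorem runCost_eq (D : Setup f L Y ℓ) {β : ℝ → Measure A} (hβ : IsRelaxedControl β) (x : Eu N)
    {t : ℝ} (ht : 0 ≤ t) : runCost ℓ β (Y x β) t = ENNReal.ofReal (J ℓ Y x β t) := by
  unfold runCost J
  rw [intervalIntegral.integral_of_le ht, ofReal_integral_eq_lintegral_ofReal]
  · exact (intervalIntegrable_iff_integrableOn_Ioc_of_le ht).1 (J_ii D hβ x 0 t)
  · filter_upwards with s using relℓ_nonneg D _ _

theorem J_nonneg (D : Setup f L Y ℓ) (β : ℝ → Measure A) (x : Eu N)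
    {t : ℝ} (ht : 0 ≤ t) : 0 ≤ J ℓ Y x β t :=
  intervalIntegral.integral_nonneg ht fun _ _ => relℓ_nonneg D _ _

theorem J_add (D : Setup f L Y ℓ) {β : ℝ → Measure A} (hβ : IsRelaxedControl β) (x : Eu N)
    {t s : ℝ} (ht : 0 ≤ t) (hs : 0 ≤ s) :
    J ℓ Y x β (t + s) = J ℓ Y x β t + J ℓ Y (Y x β t) (shift t β) s := by
  unfold J
  have e : ∫ r in (0:ℝ)..s, ∫ a, ℓ (Y (Y x β t) (shift t β) r) a ∂(shift t β r) =
      ∫ r in t..(t+s), ∫ a, ℓ (Y x β r) a ∂(β r) := by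
    have := intervalIntegral.integral_comp_add_left (a := 0) (b := s)
      (fun r => ∫ a, ℓ (Y x β r) a ∂(β r)) t
    rw [add_zero] at this
    rw [← this]
    apply intervalIntegral.integral_congr
    intro r hr
    rw [uIcc_of_le hs] at hr
    simp only
    rw [Y_shift D.toDyn hβ x ht hr.1]
    rfl
  rw [e, intervalIntegral.integral_add_adjacent_intervals (J_ii D hβ x _ _) (J_ii D hβ x _ _)]

theorem J_mono (D : Setup f L Y ℓ) {β : ℝ → Measure A} (hβ : IsRelaxedControl β) (x : Eu N)
    {s t : ℝ} (hs : 0 ≤ s) (hst : s ≤ t) : J ℓ Y x β s ≤ J ℓ Y x β t := by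
  have := J_add D hβ x hs (sub_nonneg.2 hst)
  rw [add_sub_cancel] at this
  have h2 := J_nonneg D (shift s β) (Y x β s) (sub_nonneg.2 hst)
  linarith

theorem J_congr (D : Setup f L Y ℓ) {β β' : ℝ → Measure A} (hβ : IsRelaxedControl β)
    (hβ' : IsRelaxedControl β') (x : Eu N) {t : ℝ} (ht : 0 ≤ t)
    (hb : ∀ s ∈ Ioc 0 t, β s = β' s) : J ℓ Y x β t = J ℓ Y x β' t := by
  unfold J
  apply intervalIntegral.integral_congr_ae
  filter_upwards with s hs
  rw [uIoc_of_le ht] at hs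
  rw [Y_congr D.toDyn hβ hβ' x hb s ⟨hs.1.le, hs.2⟩, hb s hs]

theorem J_concat (D : Setup f L Y ℓ) {β β' : ℝ → Measure A} (hβ : IsRelaxedControl β)
    (hβ' : IsRelaxedControl β') (x : Eu N) {t s : ℝ} (ht : 0 ≤ t) (hs : 0 ≤ s) :
    J ℓ Y x (concat t β β') (t + s) = J ℓ Y x β t + J ℓ Y (Y x β t) β' s := by
  have hc := concat_relaxed hβ hβ' t
  rw [J_add D hc x ht hs, Y_concat_left D.toDyn hβ hβ' x (right_mem_Icc.2 ht)]
  congr 1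
  · exact J_congr D hc hβ x ht fun r hr => by simp [concat, hr.2]
  · exact J_congr D (shift_relaxed hc t) hβ' _ hs fun r hr => by simp [shift, concat, hr.1]

theorem freeze (D : Setup f L Y ℓ) {β : ℝ → Measure A} (hβ : IsRelaxedControl β)
    (z ξ P : Eu N) {h d δ : ℝ} (hh : 0 ≤ h)
    (hd : ∀ s ∈ Icc 0 h, ‖Y z β s - ξ‖ ≤ d)
    (hδ : ∀ s ∈ Icc 0 h, ∀ a, |ℓ (Y z β s) a - ℓ ξ a| ≤ δ) :
    |J ℓ Y z β h + ⟪P, Y z β h - z⟫ - ∫ s in (0:ℝ)..h, ∫ a, (⟪P, f ξ a⟫ + ℓ ξ a) ∂(β s)|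
      ≤ h * (‖P‖ * (L * d) + δ) := by
  set G : Eu N → A → ℝ := fun x a => ⟪P, f x a⟫ + ℓ x a with hG
  have hPf : Continuous fun q : Eu N × A => ⟪P, f q.1 q.2⟫ := continuous_const.inner D.hf
  have hGc : Continuous fun q : Eu N × A => G q.1 q.2 := hPf.add D.hℓ
  have hYc := D.Yc hβ z
  have e1 : J ℓ Y z β h + ⟪P, Y z β h - z⟫ = ∫ s in (0:ℝ)..h, ∫ a, G (Y z β s) a ∂(β s) := by
    rw [(D.hY z β hβ).2.2 h hh, add_sub_cancel_left]
    have e2 : ⟪P, ∫ s in (0:ℝ)..h, ∫ a, f (Y z β s) a ∂(β s)⟫ =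
        ∫ s in (0:ℝ)..h, ∫ a, ⟪P, f (Y z β s) a⟫ ∂(β s) := by
      have := (innerSL ℝ P).intervalIntegral_comp_comm (rel_ii D.hf hβ hYc 0 h)
      simp only [innerSL_apply_apply] at this
      rw [← this]
      apply intervalIntegral.integral_congr
      intro s _
      simp only
      have := hβ.1 s
      exact (integral_inner (cont_integrable (β s) (cont_slice D.hf (Y z β s))) P).symm
    rw [e2, add_comm]
    unfold J
    rw [← intervalIntegral.integral_add (rel_ii (g := fun x a => ⟪P, f x a⟫) hPf hβ hYc 0 h)
      (J_ii D hβ z 0 h)]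
    apply intervalIntegral.integral_congr
    intro s _
    simp only [hG]
    have := hβ.1 s
    rw [integral_add (cont_integrable (β s) (cont_slice (g := fun x a => ⟪P, f x a⟫) hPf (Y z β s)))
      (cont_integrable (β s) (cont_slice D.hℓ (Y z β s)))]
  rw [e1, ← intervalIntegral.integral_sub (rel_ii hGc hβ hYc 0 h)
    (rel_ii hGc hβ (y := fun _ => ξ) continuous_const 0 h), ← Real.norm_eq_abs]
  refine (intervalIntegral.norm_integral_le_of_norm_le_const
    (C := ‖P‖ * (L * d) + δ) ?_).trans (by rw [sub_zero, abs_of_nonneg hh, mul_comm])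
  intro s hs
  rw [uIoc_of_le hh] at hs
  have hs' : s ∈ Icc 0 h := ⟨hs.1.le, hs.2⟩
  have := hβ.1 s
  rw [← integral_sub (cont_integrable (β s) (cont_slice hGc _))
    (cont_integrable (β s) (cont_slice hGc _))]
  refine rel_bound (β s) fun a => ?_
  have e3 : G (Y z β s) a - G ξ a = ⟪P, f (Y z β s) a - f ξ a⟫ + (ℓ (Y z β s) a - ℓ ξ a) := by
    simp only [hG, inner_sub_right]; ring
  rw [e3]
  refine (norm_add_le _ _).trans (add_le_add ?_ (hδ s hs' a))
  refine (norm_inner_le_norm _ _).trans ?_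
  gcongr
  refine (D.hfLip _ _ _).trans ?_
  have := D.hL
  gcongr
  exact hd s hs'

section Val

variable {T : Set (Eu N)} {vR : Eu N → ℝ}

theorem val_le (D : Setup f L Y ℓ) (hv : ∀ x, valueFn T ℓ Y x = (vR x : EReal))
    {β : ℝ → Measure A} (hβ : IsRelaxedControl β) (x : Eu N) {t : ℝ} (ht : 0 ≤ t)
    (hT : Y x β t ∈ T) : vR x ≤ J ℓ Y x β t := by
  have hmem : t ∈ exitTimes T (Y x β) := ⟨ht, hT⟩
  have hbd : BddBelow (exitTimes T (Y x β)) := ⟨0, fun s hs => hs.1⟩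
  have h0 : 0 ≤ sInf (exitTimes T (Y x β)) := le_csInf ⟨t, hmem⟩ fun s hs => hs.1
  have h1 : sInf (exitTimes T (Y x β)) ≤ t := csInf_le hbd hmem
  have h2 : valueFn T ℓ Y x ≤ ((runCost ℓ β (Y x β) (sInf (exitTimes T (Y x β)))) : EReal) :=
    sInf_le ⟨β, hβ, ⟨t, hmem⟩, rfl⟩
  rw [hv, runCost_eq D hβ x h0, EReal.coe_ennreal_ofReal, max_eq_left (J_nonneg D β x h0),
    EReal.coe_le_coe_iff] at h2
  exact h2.trans (J_mono D hβ x h0 h1)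

theorem val_approx (D : Setup f L Y ℓ) (hTcl : IsClosed T)
    (hv : ∀ x, valueFn T ℓ Y x = (vR x : EReal)) (x : Eu N) {ε : ℝ} (hε : 0 < ε) :
    ∃ β t, IsRelaxedControl β ∧ 0 ≤ t ∧ Y x β t ∈ T ∧ (∀ s ∈ Ico 0 t, Y x β s ∉ T) ∧
      J ℓ Y x β t < vR x + ε := by
  have h : valueFn T ℓ Y x < ((vR x + ε : ℝ) : EReal) := by
    rw [hv, EReal.coe_lt_coe_iff]; linarith
  unfold valueFn at h
  rw [sInf_lt_iff] at h
  obtain ⟨c, ⟨β, hβ, hne, rfl⟩, hc⟩ := h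
  have hbd : BddBelow (exitTimes T (Y x β)) := ⟨0, fun s hs => hs.1⟩
  have hcl : IsClosed (exitTimes T (Y x β)) :=
    isClosed_Ici.inter (hTcl.preimage (D.Yc hβ x))
  have hm := hcl.csInf_mem hne hbd
  refine ⟨β, _, hβ, hm.1, hm.2, ?_, ?_⟩
  · intro s hs hsT
    exact absurd (csInf_le hbd (show s ∈ exitTimes T (Y x β) from ⟨hs.1, hsT⟩)) (not_le.2 hs.2)
  · rw [runCost_eq D hβ x hm.1, EReal.coe_ennreal_ofReal, max_eq_left (J_nonneg D β x hm.1),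
      EReal.coe_lt_coe_iff] at hc
    exact hc

theorem val_nonneg (D : Setup f L Y ℓ) (hTcl : IsClosed T)
    (hv : ∀ x, valueFn T ℓ Y x = (vR x : EReal)) (x : Eu N) : 0 ≤ vR x := by
  refine le_of_forall_pos_le_add fun ε hε => ?_
  obtain ⟨β, t, hβ, ht, -, -, h⟩ := val_approx D hTcl hv x hε
  linarith [J_nonneg D β x ht]

theorem val_zero [Nonempty A] (D : Setup f L Y ℓ) (hTcl : IsClosed T)
    (hv : ∀ x, valueFn T ℓ Y x = (vR x : EReal)) {x : Eu N} (hx : x ∈ T) : vR x = 0 := by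
  refine le_antisymm ?_ (val_nonneg D hTcl hv x)
  obtain ⟨a⟩ := ‹Nonempty A›
  have hβ := const_relaxed (Measure.dirac a)
  have := val_le D hv hβ x le_rfl (by rw [D.Y0 hβ]; exact hx)
  simpa [J] using this

theorem dpp_le (D : Setup f L Y ℓ) (hTcl : IsClosed T)
    (hv : ∀ x, valueFn T ℓ Y x = (vR x : EReal)) {β : ℝ → Measure A} (hβ : IsRelaxedControl β)
    (x : Eu N) {t : ℝ} (ht : 0 ≤ t) : vR x ≤ J ℓ Y x β t + vR (Y x β t) := by
  refine le_of_forall_pos_le_add fun ε hε => ?_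
  obtain ⟨β', s, hβ', hs, hT, -, h⟩ := val_approx D hTcl hv (Y x β t) hε
  have := val_le D hv (concat_relaxed hβ hβ' t) x (add_nonneg ht hs)
    (by rw [Y_concat_right D.toDyn hβ hβ' x ht hs]; exact hT)
  rw [J_concat D hβ hβ' x ht hs] at this
  linarith

theorem dpp_ge (D : Setup f L Y ℓ)
    (hv : ∀ x, valueFn T ℓ Y x = (vR x : EReal)) {β : ℝ → Measure A} (hβ : IsRelaxedControl β)
    (x : Eu N) {t t₁ : ℝ} (ht : 0 ≤ t) (htt : t ≤ t₁) (hT : Y x β t₁ ∈ T) :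
    J ℓ Y x β t + vR (Y x β t) ≤ J ℓ Y x β t₁ := by
  have hs := sub_nonneg.2 htt
  have e : t₁ = t + (t₁ - t) := by ring
  rw [e, Y_shift D.toDyn hβ x ht hs] at hT
  have := val_le D hv (shift_relaxed hβ t) _ hs hT
  rw [e, J_add D hβ x ht hs]
  linarith

end Val

end CostSec
end ExitTime

namespace ExitTime

section Visc

set_option linter.unusedSectionVars false

variable {N : ℕ} {A : Type*} [MetricSpace A] [CompactSpace A] [Nonempty A]
    [MeasurableSpace A] [BorelSpace A]
variable {f : Eu N → A → Eu N} {L : ℝ} {Y : Eu N → (ℝ → Measure A) → ℝ → Eu N}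
  {ℓ : Eu N → A → ℝ} {T : Set (Eu N)} {vR : Eu N → ℝ}

/-- the (negated) pre-Hamiltonian -/
def G (f : Eu N → A → Eu N) (ℓ : Eu N → A → ℝ) (x p : Eu N) (a : A) : ℝ := ⟪p, f x a⟫ + ℓ x a

theorem G_cont (D : Setup f L Y ℓ) (x p : Eu N) : Continuous (G f ℓ x p) :=
  (continuous_const.inner (cont_slice D.hf x)).add (cont_slice D.hℓ x)

theorem ham_eq (D : Setup f L Y ℓ) (x p : Eu N) (m : Measure A) [IsProbabilityMeasure m] :
    (-(inner (𝕜 := ℝ) (∫ a, f x a ∂m) p : ℝ) - ∫ a, ℓ x a ∂m) = - ∫ a, G f ℓ x p a ∂m := by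
  unfold G
  have h1 := cont_integrable m (cont_slice D.hf x)
  rw [integral_add (h1.const_inner p) (cont_integrable m (cont_slice D.hℓ x)),
    integral_inner h1, real_inner_comm]
  ring

theorem HJB_bdd (D : Setup f L Y ℓ) (x p : Eu N) : BddAbove (range fun m : ProbabilityMeasure A =>
    (-(inner (𝕜 := ℝ) (∫ a, f x a ∂(m : Measure A)) p : ℝ) - ∫ a, ℓ x a ∂(m : Measure A))) := by
  obtain ⟨C, hC⟩ := isCompact_univ.exists_bound_of_continuousOn (G_cont D x p).continuousOn
  refine ⟨C, ?_⟩
  rintro _ ⟨m, rfl⟩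
  simp only
  rw [ham_eq D]
  have := rel_bound (m : Measure A) (g := G f ℓ x p) (C := C) fun a => hC a (mem_univ a)
  rw [Real.norm_eq_abs] at this
  linarith [(abs_le.1 this).1]

theorem le_HJB (D : Setup f L Y ℓ) (x p : Eu N) (m : Measure A) [hm : IsProbabilityMeasure m] :
    - ∫ a, G f ℓ x p a ∂m ≤ HJB f ℓ x p := by
  rw [← ham_eq D]
  exact le_ciSup (HJB_bdd D x p) (⟨m, hm⟩ : ProbabilityMeasure A)

theorem exists_of_HJB (D : Setup f L Y ℓ) {x p : Eu N} (h : 0 ≤ HJB f ℓ x p) {δ : ℝ} (hδ : 0 < δ) :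
    ∃ m : Measure A, IsProbabilityMeasure m ∧ ∫ a, G f ℓ x p a ∂m ≤ δ := by
  have h' : -δ < HJB f ℓ x p := by linarith
  have : Nonempty (ProbabilityMeasure A) := by
    obtain ⟨a⟩ := ‹Nonempty A›
    exact ⟨⟨Measure.dirac a, inferInstance⟩⟩
  obtain ⟨m, hm⟩ := exists_lt_of_lt_ciSup h'
  rw [ham_eq D] at hm
  exact ⟨m, inferInstance, by linarith⟩

theorem unif_ball {g : Eu N → A → ℝ} (hg : Continuous fun q : Eu N × A => g q.1 q.2) (R : ℝ)
    {δ : ℝ} (hδ : 0 < δ) : ∃ ρ > 0, ∀ x ∈ closedBall (0 : Eu N) R, ∀ x' ∈ closedBall (0 : Eu N) R,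
      ‖x - x'‖ ≤ ρ → ∀ a, |g x a - g x' a| ≤ δ := by
  have hK : IsCompact (closedBall (0 : Eu N) R ×ˢ (univ : Set A)) :=
    (isCompact_closedBall _ _).prod isCompact_univ
  have hu := hK.uniformContinuousOn_of_continuous hg.continuousOn
  rw [Metric.uniformContinuousOn_iff_le] at hu
  obtain ⟨ρ, hρ, h⟩ := hu δ hδ
  refine ⟨ρ, hρ, fun x hx x' hx' hxx a => ?_⟩
  have := h (x, a) ⟨hx, mem_univ _⟩ (x', a) ⟨hx', mem_univ _⟩ (by
    rw [Prod.dist_eq]; simp [dist_eq_norm, hxx, hρ.le])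
  simpa [Real.dist_eq] using this

theorem traj_bound (D : Setup f L Y ℓ) (R : ℝ) : ∃ M > 0, ∀ z ∈ closedBall (0 : Eu N) R,
    ∀ β, IsRelaxedControl β → ∀ s ∈ Icc (0:ℝ) 1, ‖Y z β s - z‖ ≤ M * s := by
  have hK : IsCompact (closedBall (0 : Eu N) R ×ˢ (univ : Set A)) :=
    (isCompact_closedBall _ _).prod isCompact_univ
  obtain ⟨C, hC⟩ := hK.exists_bound_of_continuousOn D.hf.continuousOn
  refine ⟨max C 1 * Real.exp L, by positivity, fun z hz β hβ s hs => ?_⟩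
  refine (Y_growth D.toDyn hβ z (C := max C 1) (fun a =>
    (hC (z, a) ⟨hz, mem_univ _⟩).trans (le_max_left _ _)) hs.1).trans ?_
  have h1 : Real.exp (L * s) ≤ Real.exp L :=
    Real.exp_le_exp.2 (by nlinarith [D.hL, hs.2])
  calc max C 1 * s * Real.exp (L * s) ≤ max C 1 * s * Real.exp L := by
        have := hs.1
        gcongr
    _ = _ := by ring

theorem local_exp (D : Setup f L Y ℓ) {x₀ p : Eu N} {γ : Eu N → ℝ} (hγ : HasGradientAt γ p x₀)
    {U : Set (Eu N)} (hU : U ∈ 𝓝 x₀) {η : ℝ} (hη : 0 < η) :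
    ∃ t₀ > 0, ∀ β, IsRelaxedControl β → ∀ t ∈ Icc 0 t₀, Y x₀ β t ∈ U ∧
      |J ℓ Y x₀ β t + (γ (Y x₀ β t) - γ x₀) - ∫ s in (0:ℝ)..t, ∫ a, G f ℓ x₀ p a ∂(β s)| ≤ η * t := by
  obtain ⟨M, hM, hMb⟩ := traj_bound D (‖x₀‖ + 1)
  obtain ⟨ρ, hρ, hℓu⟩ := unif_ball D.hℓ (‖x₀‖ + 1) (δ := η / 3) (by positivity)
  have h1 : ∀ᶠ x in 𝓝 x₀, ‖γ x - γ x₀ - ⟪p, x - x₀⟫‖ ≤ η / (3 * M) * ‖x - x₀‖ := by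
    have := hasGradientAt_iff_isLittleO.1 hγ
    exact this.def (by positivity)
  obtain ⟨r, hr, hrb⟩ := Metric.eventually_nhds_iff_ball.1 (h1.and hU)
  have hL := D.hL
  set t₀ := min (min 1 (ρ / M)) (min (r / (2 * M)) (min (1 / M) (η / (3 * ((‖p‖ + 1) * (L * M))))))
    with ht₀
  have ht0pos : 0 < t₀ := by
    simp only [ht₀, lt_min_iff]
    refine ⟨⟨one_pos, by positivity⟩, by positivity, by positivity, by positivity⟩
  have a1 : t₀ ≤ 1 := (min_le_left _ _).trans (min_le_left _ _)
  have a2 : M * t₀ ≤ ρ := by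
    have : t₀ ≤ ρ / M := (min_le_left _ _).trans (min_le_right _ _)
    rwa [le_div_iff₀ hM, mul_comm] at this
  have a3 : M * t₀ < r := by
    have : t₀ ≤ r / (2 * M) := (min_le_right _ _).trans (min_le_left _ _)
    rw [le_div_iff₀ (by positivity)] at this
    linarith
  have a4 : M * t₀ ≤ 1 := by
    have : t₀ ≤ 1 / M := (min_le_right _ _).trans ((min_le_right _ _).trans (min_le_left _ _))
    rwa [le_div_iff₀ hM, mul_comm] at this
  have a5 : ‖p‖ * (L * (M * t₀)) ≤ η / 3 := by
    have : t₀ ≤ η / (3 * ((‖p‖ + 1) * (L * M))) :=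
      (min_le_right _ _).trans ((min_le_right _ _).trans (min_le_right _ _))
    rw [le_div_iff₀ (by positivity)] at this
    have h0 : 0 ≤ L * (M * t₀) := by positivity
    nlinarith
  refine ⟨t₀, ht0pos, fun β hβ t ht => ?_⟩
  have hx0 : x₀ ∈ closedBall (0 : Eu N) (‖x₀‖ + 1) := by simp
  have hY : ∀ s ∈ Icc 0 t, ‖Y x₀ β s - x₀‖ ≤ M * s := fun s hs =>
    hMb x₀ hx0 β hβ s ⟨hs.1, hs.2.trans (ht.2.trans a1)⟩
  have hY' : ∀ s ∈ Icc 0 t, ‖Y x₀ β s - x₀‖ ≤ M * t₀ := fun s hs =>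
    (hY s hs).trans (by gcongr; exact hs.2.trans ht.2)
  have htt : t ∈ Icc 0 t := ⟨ht.1, le_rfl⟩
  have hYball : Y x₀ β t ∈ ball x₀ r := by
    rw [mem_ball, dist_eq_norm]; exact (hY' t htt).trans_lt a3
  obtain ⟨hg, hUm⟩ := hrb _ hYball
  refine ⟨hUm, ?_⟩
  have hfr := freeze D hβ x₀ x₀ p (d := M * t₀) (δ := η / 3) ht.1 hY' (fun s hs a =>
    hℓu _ (by
      rw [mem_closedBall, dist_zero_right]
      have h2 : ‖Y x₀ β s‖ ≤ ‖x₀‖ + ‖Y x₀ β s - x₀‖ := by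
        simpa using norm_add_le x₀ (Y x₀ β s - x₀)
      linarith [hY' s hs]) x₀ hx0 ((hY' s hs).trans a2) a)
  have hg2 : |γ (Y x₀ β t) - γ x₀ - ⟪p, Y x₀ β t - x₀⟫| ≤ η / 3 * t := by
    rw [← Real.norm_eq_abs]
    refine hg.trans ?_
    calc η / (3 * M) * ‖Y x₀ β t - x₀‖ ≤ η / (3 * M) * (M * t) := by
          gcongr; exact hY t htt
      _ = _ := by field_simp
  have hfr2 : t * (‖p‖ * (L * (M * t₀)) + η / 3) ≤ t * (η / 3 + η / 3) :=
    mul_le_mul_of_nonneg_left (by linarith) ht.1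
  have hfr3 := hfr.trans hfr2
  rw [abs_le] at hfr3 hg2 ⊢
  change _ ≤ J ℓ Y x₀ β t + ⟪p, Y x₀ β t - x₀⟫ - (∫ s in (0:ℝ)..t, ∫ a, G f ℓ x₀ p a ∂(β s)) ∧
    J ℓ Y x₀ β t + ⟪p, Y x₀ β t - x₀⟫ - (∫ s in (0:ℝ)..t, ∫ a, G f ℓ x₀ p a ∂(β s)) ≤ _ at hfr3
  constructor <;> linarith [hfr3.1, hfr3.2, hg2.1, hg2.2]

theorem val_viscosity (D : Setup f L Y ℓ) (hTcl : IsClosed T)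
    (hv : ∀ x, valueFn T ℓ Y x = (vR x : EReal)) : IsViscositySol (HJB f ℓ) Tᶜ vR := by
  have hO : IsOpen Tᶜ := hTcl.isOpen_compl
  constructor
  · intro γ hγ x₀ hx₀ hmin
    have hgr : HasGradientAt γ (gradient γ x₀) x₀ :=
      ((hγ.differentiableOn one_ne_zero).differentiableAt (hO.mem_nhds hx₀)).hasGradientAt
    set p := gradient γ x₀ with hp
    by_contra hcon
    push Not at hcon
    set θ := - HJB f ℓ x₀ p with hθ
    have hθpos : 0 < θ := by linarith
    have hmin' : ∀ᶠ x in 𝓝 x₀, vR x₀ - γ x₀ ≤ vR x - γ x := by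
      have := hmin
      rw [IsLocalMinOn, IsMinFilter, hO.nhdsWithin_eq hx₀] at this
      exact this
    obtain ⟨t₀, ht₀, h⟩ := local_exp D hgr (hmin'.and (hO.mem_nhds hx₀)) (η := θ / 2) (by positivity)
    obtain ⟨β, t₁, hβ, ht₁, hT, -, hJ⟩ := val_approx D hTcl hv x₀ (ε := θ * t₀ / 4) (by positivity)
    have hlt : t₀ ≤ t₁ := by
      by_contra hlt
      push Not at hlt
      exact (h β hβ t₁ ⟨ht₁, hlt.le⟩).1.2 hT
    obtain ⟨⟨hm, -⟩, hest⟩ := h β hβ t₀ ⟨ht₀.le, le_rfl⟩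
    have hd := dpp_ge D hv hβ x₀ ht₀.le hlt hT
    have hinteg : θ * t₀ ≤ ∫ s in (0:ℝ)..t₀, ∫ a, G f ℓ x₀ p a ∂(β s) := by
      have h1 : ∫ s in (0:ℝ)..t₀, θ = θ * t₀ := by simp [mul_comm]
      rw [← h1]
      refine intervalIntegral.integral_mono_on ht₀.le (by simp)
        (relaxed_ii hβ (φ := fun q => G f ℓ x₀ p q.2) ((G_cont D x₀ p).comp continuous_snd) _ _) ?_
      intro s _
      have := hβ.1 s
      linarith [le_HJB D x₀ p (β s)]
    have := (abs_le.1 hest).1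
    have : 0 < θ * t₀ := by positivity
    linarith
  · intro γ hγ x₀ hx₀ hmax
    have hgr : HasGradientAt γ (gradient γ x₀) x₀ :=
      ((hγ.differentiableOn one_ne_zero).differentiableAt (hO.mem_nhds hx₀)).hasGradientAt
    set p := gradient γ x₀ with hp
    have hmax' : ∀ᶠ x in 𝓝 x₀, vR x - γ x ≤ vR x₀ - γ x₀ := by
      have := hmax
      rw [IsLocalMaxOn, IsMaxFilter, hO.nhdsWithin_eq hx₀] at this
      exact this
    have : Nonempty (ProbabilityMeasure A) := by
      obtain ⟨a⟩ := ‹Nonempty A›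
      exact ⟨⟨Measure.dirac a, inferInstance⟩⟩
    refine ciSup_le fun m => ?_
    rw [ham_eq D]
    refine le_of_forall_pos_le_add fun η hη => ?_
    obtain ⟨t₀, ht₀, h⟩ := local_exp D hgr hmax' hη
    have hβ := const_relaxed (m : Measure A)
    obtain ⟨hm, hest⟩ := h _ hβ t₀ ⟨ht₀.le, le_rfl⟩
    have hd := dpp_le D hTcl hv hβ x₀ ht₀.le
    rw [intervalIntegral.integral_const, sub_zero, smul_eq_mul] at hest
    have h3 := (abs_le.1 hest).2
    have hm' : vR (Y x₀ (fun _ => (m : Measure A)) t₀) - γ (Y x₀ (fun _ => (m : Measure A)) t₀)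
      ≤ vR x₀ - γ x₀ := hm
    have h4 : 0 ≤ t₀ * (∫ a, G f ℓ x₀ p a ∂(m : Measure A)) + t₀ * η := by
      linarith
    rw [← mul_add] at h4
    have := nonneg_of_mul_nonneg_right h4 ht₀
    linarith

end Visc
end ExitTime

namespace ExitTime

section Opt

set_option linter.unusedSectionVars false

variable {N : ℕ} {A : Type*} [MetricSpace A] [CompactSpace A] [Nonempty A]
    [MeasurableSpace A] [BorelSpace A]
variable {f : Eu N → A → Eu N} {L : ℝ} {Y : Eu N → (ℝ → Measure A) → ℝ → Eu N}
  {ℓ : Eu N → A → ℝ} {T : Set (Eu N)} {vR : Eu N → ℝ}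

theorem grad_quad (c : ℝ) (z ξ : Eu N) :
    gradient (fun x : Eu N => c * ‖x - z‖ ^ 2) ξ = (2 * c) • (ξ - z) := by
  apply HasGradientAt.gradient
  rw [hasGradientAt_iff_hasFDerivAt]
  have h1 : HasFDerivAt (fun x : Eu N => x - z) (ContinuousLinearMap.id ℝ (Eu N)) ξ :=
    (hasFDerivAt_id ξ).sub_const z
  have h2 := (h1.norm_sq).const_mul c
  refine h2.congr_fderiv ?_
  ext v
  simp [inner_smul_left]
  ring

theorem quad_smooth (c : ℝ) (z : Eu N) (S : Set (Eu N)) :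
    ContDiffOn ℝ 1 (fun x : Eu N => c * ‖x - z‖ ^ 2) S :=
  (contDiff_const.mul ((contDiff_id.sub contDiff_const).norm_sq ℝ)).contDiffOn

theorem prep (D : Setup f L Y ℓ) (hTcl : IsClosed T) {w : Eu N → ℝ} (hw : Continuous w) (R : ℝ)
    {K : Set (Eu N)} (hK : IsCompact K) (hKT : K ⊆ Tᶜ) {δ : ℝ} (hδ : 0 < δ) :
    ∃ ρ > 0, ∃ k > 0, ∃ h₀ > 0,
      (∀ z ∈ closedBall (0 : Eu N) R, ∀ ξ ∈ closedBall z ρ, |w ξ - w z| ≤ δ) ∧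
      (∀ z ∈ K, closedBall z ρ ⊆ Tᶜ) ∧
      (∀ r : ℝ, 0 ≤ r → k * r ^ 2 ≤ δ → r ≤ ρ / 2) ∧
      (∀ z ∈ closedBall (0 : Eu N) R, ∀ β, IsRelaxedControl β → ∀ h ∈ Icc 0 h₀,
        ‖Y z β h - z‖ ≤ ρ / 2) ∧
      (∀ z ∈ closedBall (0 : Eu N) R, ∀ ξ, k * ‖ξ - z‖ ^ 2 ≤ δ → ∀ c, |c| = 2 * k →
        ∀ β, IsRelaxedControl β → ∀ h ∈ Icc 0 h₀,
        |J ℓ Y z β h + ⟪c • (ξ - z), Y z β h - z⟫ -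
          ∫ s in (0:ℝ)..h, ∫ a, G f ℓ ξ (c • (ξ - z)) a ∂(β s)| + k * ‖Y z β h - z‖ ^ 2
          ≤ h * ((2 * L + 2) * δ)) := by
  obtain ⟨M, hM, hMb⟩ := traj_bound D R
  obtain ⟨ρ₁, hρ₁, h₁⟩ := unif_ball D.hℓ (R + 1) hδ
  obtain ⟨ρ₂, hρ₂, h₂⟩ := unif_ball (A := A) (g := fun x _ => w x) (hw.comp continuous_fst) (R + 1) hδ
  obtain ⟨ρ₃, hρ₃, h₃⟩ := hK.exists_cthickening_subset_open hTcl.isOpen_compl hKT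
  have hL := D.hL
  set ρ := min (min ρ₁ ρ₂) (min ρ₃ 1) with hρdef
  have hρ : 0 < ρ := by simp only [hρdef, lt_min_iff]; exact ⟨⟨hρ₁, hρ₂⟩, hρ₃, one_pos⟩
  have r1 : ρ ≤ ρ₁ := (min_le_left _ _).trans (min_le_left _ _)
  have r2 : ρ ≤ ρ₂ := (min_le_left _ _).trans (min_le_right _ _)
  have r3 : ρ ≤ ρ₃ := (min_le_right _ _).trans (min_le_left _ _)
  have r4 : ρ ≤ 1 := (min_le_right _ _).trans (min_le_right _ _)
  set k := 4 * δ / ρ ^ 2 with hkdef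
  have hk : 0 < k := by positivity
  set h₀ := min 1 (min (ρ / (2 * M)) (δ / (k * (ρ * L * M + M ^ 2)))) with hh₀
  have hh₀pos : 0 < h₀ := by
    simp only [hh₀, lt_min_iff]; exact ⟨one_pos, by positivity, by positivity⟩
  have b1 : h₀ ≤ 1 := min_le_left _ _
  have b2 : M * h₀ ≤ ρ / 2 := by
    have : h₀ ≤ ρ / (2 * M) := (min_le_right _ _).trans (min_le_left _ _)
    rw [le_div_iff₀ (by positivity)] at this
    linarith
  have b3 : h₀ * (k * (ρ * L * M + M ^ 2)) ≤ δ := by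
    have : h₀ ≤ δ / (k * (ρ * L * M + M ^ 2)) := (min_le_right _ _).trans (min_le_right _ _)
    rwa [le_div_iff₀ (by positivity)] at this
  have hball : ∀ z ∈ closedBall (0 : Eu N) R, ∀ ξ, ‖ξ - z‖ ≤ ρ → ξ ∈ closedBall (0 : Eu N) (R + 1) := by
    intro z hz ξ hξ
    rw [mem_closedBall, dist_zero_right] at hz ⊢
    have h2 : ‖ξ‖ ≤ ‖z‖ + ‖ξ - z‖ := by simpa using norm_add_le z (ξ - z)
    linarith
  have hsmall : ∀ r : ℝ, 0 ≤ r → k * r ^ 2 ≤ δ → r ≤ ρ / 2 := by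
    intro r hr hkr
    have h5 : r ^ 2 ≤ (ρ / 2) ^ 2 := by
      rw [hkdef, div_mul_eq_mul_div, div_le_iff₀ (by positivity)] at hkr
      have : δ * (4 * r ^ 2) ≤ δ * ρ ^ 2 := by linarith
      have := le_of_mul_le_mul_left this hδ
      nlinarith
    exact (sq_le_sq₀ hr (by positivity)).1 h5
  refine ⟨ρ, hρ, k, hk, h₀, hh₀pos, ?_, ?_, hsmall, ?_, ?_⟩
  · intro z hz ξ hξ
    rw [mem_closedBall, dist_eq_norm] at hξ
    exact h₂ ξ (hball z hz ξ hξ) z (hball z hz z (by simp [hρ.le])) (hξ.trans r2)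
      (Classical.arbitrary A)
  · intro z hz
    exact ((closedBall_subset_cthickening hz ρ).trans (cthickening_mono r3 K)).trans h₃
  · intro z hz β hβ h hh
    refine (hMb z hz β hβ h ⟨hh.1, hh.2.trans b1⟩).trans (le_trans ?_ b2)
    gcongr; exact hh.2
  · intro z hz ξ hξ c hc β hβ h hh
    set r := ‖ξ - z‖ with hr
    have hr0 : 0 ≤ r := norm_nonneg _
    have hrρ : r ≤ ρ / 2 := hsmall r hr0 hξ
    have hYz : ∀ s ∈ Icc 0 h, ‖Y z β s - z‖ ≤ M * h := fun s hs =>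
      (hMb z hz β hβ s ⟨hs.1, hs.2.trans (hh.2.trans b1)⟩).trans (by gcongr; exact hs.2)
    have hMh : M * h ≤ ρ / 2 := le_trans (by gcongr; exact hh.2) b2
    have hYξ : ∀ s ∈ Icc 0 h, ‖Y z β s - ξ‖ ≤ r + M * h := fun s hs => by
      have h6 : ‖Y z β s - ξ‖ ≤ ‖Y z β s - z‖ + ‖z - ξ‖ := norm_sub_le_norm_sub_add_norm_sub _ _ _
      rw [norm_sub_rev z ξ] at h6
      linarith [hYz s hs]
    have hfr := freeze D hβ z ξ (c • (ξ - z)) (d := r + M * h) (δ := δ) hh.1 hYξ (fun s hs a =>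
      h₁ _ (hball z hz _ ((hYz s hs).trans (by linarith))) _ (hball z hz ξ (by linarith))
        (by linarith [hYξ s hs]) a)
    have hP : ‖c • (ξ - z)‖ = 2 * k * r := by rw [norm_smul, Real.norm_eq_abs, hc]
    rw [hP] at hfr
    have hsq : k * ‖Y z β h - z‖ ^ 2 ≤ k * (M * h) ^ 2 := by
      gcongr; exact hYz h ⟨hh.1, le_rfl⟩
    have e1 : 2 * k * r * (L * (r + M * h)) ≤ 2 * L * δ + k * ρ * L * M * h := by
      have : 2 * k * r * (L * (r + M * h)) = 2 * L * (k * r ^ 2) + (2 * r) * (k * L * M * h) := by ring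
      rw [this]
      have h7 : 0 ≤ k * L * M * h := by have := hh.1; positivity
      have h8 : (2 * r) * (k * L * M * h) ≤ ρ * (k * L * M * h) :=
        mul_le_mul_of_nonneg_right (by linarith) h7
      have h9 : 2 * L * (k * r ^ 2) ≤ 2 * L * δ := by gcongr
      linarith
    have e2 : h * (k * (ρ * L * M + M ^ 2)) ≤ δ := le_trans (by gcongr; exact hh.2) b3
    have e3 : h * (2 * k * r * (L * (r + M * h)) + δ) + k * (M * h) ^ 2 ≤ h * ((2 * L + 2) * δ) := by
      have : h * (2 * k * r * (L * (r + M * h)) + δ) + k * (M * h) ^ 2 =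
        h * (2 * k * r * (L * (r + M * h)) + δ + k * M ^ 2 * h) := by ring
      rw [this]
      apply mul_le_mul_of_nonneg_left _ hh.1
      nlinarith
    change |J ℓ Y z β h + ⟪c • (ξ - z), Y z β h - z⟫ -
          ∫ s in (0:ℝ)..h, ∫ a, G f ℓ ξ (c • (ξ - z)) a ∂(β s)| ≤ _ at hfr
    linarith

theorem quad_id (ξ z z' : Eu N) :
    ‖ξ - z'‖ ^ 2 = ‖ξ - z‖ ^ 2 - 2 * ⟪ξ - z, z' - z⟫ + ‖z' - z‖ ^ 2 := by
  have : ξ - z' = (ξ - z) - (z' - z) := by abel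
  rw [this, norm_sub_sq_real]

theorem sub_opt (D : Setup f L Y ℓ) (hTcl : IsClosed T) {w : Eu N → ℝ} (hw : Continuous w)
    (hsol : IsViscositySol (HJB f ℓ) Tᶜ w) {β : ℝ → Measure A} (hβ : IsRelaxedControl β) (x : Eu N)
    {t₀ : ℝ} (ht₀ : 0 ≤ t₀) (hG : ∀ s ∈ Icc 0 t₀, Y x β s ∉ T) :
    w x ≤ J ℓ Y x β t₀ + w (Y x β t₀) := by
  refine le_of_forall_pos_le_add fun ε hε => ?_
  have hL := D.hL
  set K := (Y x β) '' (Icc 0 t₀) with hKdef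
  have hK : IsCompact K := isCompact_Icc.image (D.Yc hβ x)
  have hKT : K ⊆ Tᶜ := by
    rintro _ ⟨s, hs, rfl⟩
    exact hG s hs
  obtain ⟨R, hR⟩ := hK.isBounded.subset_closedBall (0 : Eu N)
  set δ := ε / (1 + t₀ * (2 * L + 2)) with hδdef
  have hδ : 0 < δ := by positivity
  obtain ⟨ρ, hρ, k, hk, h₀, hh₀, p1, p2, p3, p4, p5⟩ := prep D hTcl hw R hK hKT hδ
  have hex : ∀ z : Eu N, ∃ ξ ∈ closedBall z ρ, ∀ ξ' ∈ closedBall z ρ,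
      w ξ' - k * ‖ξ' - z‖ ^ 2 ≤ w ξ - k * ‖ξ - z‖ ^ 2 := by
    intro z
    obtain ⟨ξ, hξ, h⟩ := (isCompact_closedBall z ρ).exists_isMaxOn
      ⟨z, mem_closedBall_self hρ.le⟩ (f := fun ξ => w ξ - k * ‖ξ - z‖ ^ 2) (by fun_prop)
    exact ⟨ξ, hξ, fun ξ' hξ' => h hξ'⟩
  choose ξ hξ hmax using hex
  set Φ : Eu N → ℝ := fun z => w (ξ z) - k * ‖ξ z - z‖ ^ 2 with hΦ
  have q1 : ∀ z, w z ≤ Φ z := fun z => by simpa using hmax z z (mem_closedBall_self hρ.le)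
  have q2 : ∀ z ∈ closedBall (0 : Eu N) R, Φ z ≤ w z + δ := fun z hz => by
    have := (abs_le.1 (p1 z hz (ξ z) (hξ z))).2
    have : 0 ≤ k * ‖ξ z - z‖ ^ 2 := by positivity
    simp only [hΦ]; linarith
  have q3 : ∀ z ∈ closedBall (0 : Eu N) R, k * ‖ξ z - z‖ ^ 2 ≤ δ := fun z hz => by
    have h1 := (abs_le.1 (p1 z hz (ξ z) (hξ z))).2
    have h2 := q1 z
    simp only [hΦ] at h2; linarith
  have step : ∀ z ∈ K, ∀ β', IsRelaxedControl β' → ∀ h ∈ Icc 0 h₀,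
      Φ z ≤ Φ (Y z β' h) + J ℓ Y z β' h + h * ((2 * L + 2) * δ) := by
    intro z hz β' hβ' h hh
    have hzR := hR hz
    have hsm : ‖ξ z - z‖ ≤ ρ / 2 := p3 _ (norm_nonneg _) (q3 z hzR)
    set P := (2 * k) • (ξ z - z) with hP
    have hHJB : HJB f ℓ (ξ z) P ≤ 0 := by
      rw [hP, ← grad_quad k z (ξ z)]
      refine hsol.2 _ (quad_smooth k z _) (ξ z) (p2 z hz (hξ z)) ?_
      have : ∀ᶠ x' in 𝓝 (ξ z), w x' - k * ‖x' - z‖ ^ 2 ≤ w (ξ z) - k * ‖ξ z - z‖ ^ 2 := by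
        have : closedBall z ρ ∈ 𝓝 (ξ z) := by
          refine mem_of_superset (isOpen_ball.mem_nhds (x := ξ z) ?_) ball_subset_closedBall
          rw [mem_ball, dist_eq_norm]; linarith
        filter_upwards [this] with x' hx' using hmax z x' hx'
      exact this.filter_mono nhdsWithin_le_nhds
    have hest := p5 z hzR (ξ z) (q3 z hzR) (2 * k) (abs_of_pos (by positivity)) β' hβ' h hh
    have hinteg : 0 ≤ ∫ s in (0:ℝ)..h, ∫ a, G f ℓ (ξ z) P a ∂(β' s) := by
      refine intervalIntegral.integral_nonneg hh.1 fun s _ => ?_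
      have := hβ'.1 s
      linarith [le_HJB D (ξ z) P (β' s)]
    have hmem : ξ z ∈ closedBall (Y z β' h) ρ := by
      rw [mem_closedBall, dist_eq_norm]
      have h6 := norm_sub_le_norm_sub_add_norm_sub (ξ z) z (Y z β' h)
      rw [norm_sub_rev z] at h6
      linarith [p4 z hzR β' hβ' h hh]
    have h7 := hmax (Y z β' h) (ξ z) hmem
    rw [quad_id (ξ z) z (Y z β' h)] at h7
    have h8 : ⟪P, Y z β' h - z⟫ = 2 * k * ⟪ξ z - z, Y z β' h - z⟫ := by
      rw [hP, real_inner_smul_left]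
    have h9 := (abs_le.1 (le_of_add_le_of_nonneg_left hest (by positivity))).1
    rw [← hP] at hest
    have h10 := neg_abs_le (J ℓ Y z β' h + ⟪P, Y z β' h - z⟫ -
          ∫ s in (0:ℝ)..h, ∫ a, G f ℓ (ξ z) P a ∂(β' s))
    simp only [hΦ]
    rw [h8] at hest h10
    linarith
  obtain ⟨n, hn⟩ := exists_nat_gt (t₀ / h₀)
  have hnpos : 0 < (n : ℝ) := lt_of_le_of_lt (by positivity) hn
  set h := t₀ / n with hh
  have hhI : h ∈ Icc 0 h₀ := by
    refine ⟨by positivity, ?_⟩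
    rw [hh, div_le_iff₀ hnpos]
    rw [div_lt_iff₀ hh₀] at hn
    linarith
  have hnh : n * h = t₀ := by rw [hh]; field_simp
  have ind : ∀ j : ℕ, j ≤ n → Φ x ≤ Φ (Y x β (j * h)) + J ℓ Y x β (j * h)
      + j * h * ((2 * L + 2) * δ) := by
    intro j
    induction j with
    | zero => intro _; simp [D.Y0 hβ, J]
    | succ j ih =>
      intro hj
      have h1 := ih (by omega)
      have hj0 : 0 ≤ j * h := mul_nonneg (by positivity) hhI.1
      have hz : Y x β (j * h) ∈ K := by
        refine ⟨_, ⟨hj0, ?_⟩, rfl⟩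
        rw [← hnh]
        have : (j : ℝ) ≤ n := by exact_mod_cast (by omega : j ≤ n)
        exact mul_le_mul_of_nonneg_right this hhI.1
      have h2 := step _ hz _ (shift_relaxed hβ (j * h)) h hhI
      rw [← Y_shift D.toDyn hβ x hj0 hhI.1] at h2
      have e : ((j + 1 : ℕ) : ℝ) * h = j * h + h := by push_cast; ring
      rw [e, J_add D hβ x hj0 hhI.1]
      linarith
  have h1 := ind n le_rfl
  rw [hnh] at h1
  have h2 := q1 x
  have h3 := q2 (Y x β t₀) (hR ⟨t₀, ⟨ht₀, le_rfl⟩, rfl⟩)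
  have h4 : δ + t₀ * ((2 * L + 2) * δ) = ε := by
    rw [hδdef]; field_simp
  linarith

theorem sup_opt (D : Setup f L Y ℓ) (hTcl : IsClosed T) 
    (hv : ∀ x, valueFn T ℓ Y x = (vR x : EReal)) (hvc : Continuous vR)
    {w : Eu N → ℝ} (hw : Continuous w) (hwT : ∀ x ∈ T, w x = 0)
    (hsol : IsViscositySol (HJB f ℓ) Tᶜ w) {η δ' : ℝ} (hη : 0 < η) (hδ' : 0 < δ') (x : Eu N)
    (hx : η + δ' ≤ vR x - w x) :
    ∃ β, IsRelaxedControl β ∧ w (Y x β 1) + J ℓ Y x β 1 ≤ w x + δ' := by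
  have hL := D.hL
  obtain ⟨M, hM, hMb⟩ := traj_bound D ‖x‖
  set R := ‖x‖ + M with hRdef
  have hYR : ∀ β, IsRelaxedControl β → ∀ s ∈ Icc (0:ℝ) 1, Y x β s ∈ closedBall (0 : Eu N) R := by
    intro β hβ s hs
    rw [mem_closedBall, dist_zero_right]
    have h2 : ‖Y x β s‖ ≤ ‖x‖ + ‖Y x β s - x‖ := by simpa using norm_add_le x (Y x β s - x)
    have h3 := hMb x (by simp) β hβ s hs
    nlinarith [hs.2]
  set K := {z | η ≤ vR z - w z} ∩ closedBall (0 : Eu N) R with hKdef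
  have hK : IsCompact K :=
    (isCompact_closedBall _ _).inter_left (isClosed_le continuous_const (hvc.sub hw))
  have hKT : K ⊆ Tᶜ := by
    intro z hz hzT
    have h1 : η ≤ vR z - w z := hz.1
    rw [val_zero D hTcl hv hzT, hwT z hzT] at h1
    linarith
  set δ := δ' / (2 * L + 4) with hδdef
  have hδ : 0 < δ := by positivity
  have hδe : (2 * L + 3) * δ + δ = δ' := by rw [hδdef]; field_simp; ring
  obtain ⟨ρ, hρ, k, hk, h₀, hh₀, p1, p2, p3, p4, p5⟩ := prep D hTcl hw R hK hKT hδ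
  have hex : ∀ z : Eu N, ∃ ξ ∈ closedBall z ρ, ∀ ξ' ∈ closedBall z ρ,
      w ξ + k * ‖ξ - z‖ ^ 2 ≤ w ξ' + k * ‖ξ' - z‖ ^ 2 := by
    intro z
    obtain ⟨ξ, hξ, h⟩ := (isCompact_closedBall z ρ).exists_isMinOn
      ⟨z, mem_closedBall_self hρ.le⟩ (f := fun ξ => w ξ + k * ‖ξ - z‖ ^ 2) (by fun_prop)
    exact ⟨ξ, hξ, fun ξ' hξ' => h hξ'⟩
  choose ξ hξ hmin using hex
  set Φ : Eu N → ℝ := fun z => w (ξ z) + k * ‖ξ z - z‖ ^ 2 with hΦ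
  have q1 : ∀ z, Φ z ≤ w z := fun z => by simpa using hmin z z (mem_closedBall_self hρ.le)
  have q2 : ∀ z ∈ closedBall (0 : Eu N) R, w z ≤ Φ z + δ := fun z hz => by
    have := (abs_le.1 (p1 z hz (ξ z) (hξ z))).1
    have : 0 ≤ k * ‖ξ z - z‖ ^ 2 := by positivity
    simp only [hΦ]; linarith
  have q3 : ∀ z ∈ closedBall (0 : Eu N) R, k * ‖ξ z - z‖ ^ 2 ≤ δ := fun z hz => by
    have h1 := (abs_le.1 (p1 z hz (ξ z) (hξ z))).1
    have h2 := q1 z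
    simp only [hΦ] at h2; linarith
  have step : ∀ z ∈ K, ∀ h ∈ Icc 0 h₀, ∃ β', IsRelaxedControl β' ∧
      Φ (Y z β' h) + J ℓ Y z β' h ≤ Φ z + h * ((2 * L + 3) * δ) := by
    intro z hz h hh
    have hzR := hz.2
    have hsm : ‖ξ z - z‖ ≤ ρ / 2 := p3 _ (norm_nonneg _) (q3 z hzR)
    set P := (2 * (-k)) • (ξ z - z) with hP
    have hHJB : 0 ≤ HJB f ℓ (ξ z) P := by
      rw [hP, ← grad_quad (-k) z (ξ z)]
      refine hsol.1 _ (quad_smooth (-k) z _) (ξ z) (p2 z hz (hξ z)) ?_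
      have : ∀ᶠ x' in 𝓝 (ξ z), w (ξ z) - -k * ‖ξ z - z‖ ^ 2 ≤ w x' - -k * ‖x' - z‖ ^ 2 := by
        have : closedBall z ρ ∈ 𝓝 (ξ z) := by
          refine mem_of_superset (isOpen_ball.mem_nhds (x := ξ z) ?_) ball_subset_closedBall
          rw [mem_ball, dist_eq_norm]; linarith
        filter_upwards [this] with x' hx'
        have := hmin z x' hx'
        linarith
      exact this.filter_mono nhdsWithin_le_nhds
    obtain ⟨m, hm, hmδ⟩ := exists_of_HJB D hHJB hδ
    have hβ' := const_relaxed m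
    refine ⟨fun _ => m, hβ', ?_⟩
    set β' : ℝ → Measure A := fun _ => m with hβ'def
    have hest := p5 z hzR (ξ z) (q3 z hzR) (2 * (-k)) (by
      rw [abs_of_neg (by linarith)]; ring) β' hβ' h hh
    have hinteg : ∫ s in (0:ℝ)..h, ∫ a, G f ℓ (ξ z) P a ∂(β' s) ≤ h * δ := by
      simp only [hβ'def]
      rw [intervalIntegral.integral_const, sub_zero, smul_eq_mul]
      exact mul_le_mul_of_nonneg_left hmδ hh.1
    have hmem : ξ z ∈ closedBall (Y z β' h) ρ := by
      rw [mem_closedBall, dist_eq_norm]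
      have h6 := norm_sub_le_norm_sub_add_norm_sub (ξ z) z (Y z β' h)
      rw [norm_sub_rev z] at h6
      linarith [p4 z hzR β' hβ' h hh]
    have h7 := hmin (Y z β' h) (ξ z) hmem
    rw [quad_id (ξ z) z (Y z β' h)] at h7
    have h8 : ⟪P, Y z β' h - z⟫ = 2 * (-k) * ⟪ξ z - z, Y z β' h - z⟫ := by
      rw [hP, real_inner_smul_left]
    rw [← hP] at hest
    have h10 := le_abs_self (J ℓ Y z β' h + ⟪P, Y z β' h - z⟫ -
          ∫ s in (0:ℝ)..h, ∫ a, G f ℓ (ξ z) P a ∂(β' s))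
    simp only [hΦ]
    rw [h8] at hest h10
    linarith
  obtain ⟨n, hn⟩ := exists_nat_gt (1 / h₀)
  have hnpos : 0 < (n : ℝ) := lt_of_le_of_lt (by positivity) hn
  set h := 1 / (n : ℝ) with hh
  have hhI : h ∈ Icc 0 h₀ := by
    refine ⟨by positivity, ?_⟩
    rw [hh, div_le_iff₀ hnpos]
    rw [div_lt_iff₀ hh₀] at hn
    linarith
  have hnh : n * h = 1 := by rw [hh]; field_simp
  have ind : ∀ j : ℕ, j ≤ n → ∃ β, IsRelaxedControl β ∧ Φ (Y x β (j * h)) + J ℓ Y x β (j * h)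
      ≤ Φ x + j * h * ((2 * L + 3) * δ) := by
    intro j
    induction j with
    | zero =>
      intro _
      have hβ := const_relaxed (Measure.dirac (Classical.arbitrary A))
      exact ⟨_, hβ, by simp [D.Y0 hβ, J]⟩
    | succ j ih =>
      intro hj
      obtain ⟨β, hβ, h1⟩ := ih (by omega)
      have hj0 : 0 ≤ j * h := mul_nonneg (by positivity) hhI.1
      have hj1 : j * h ≤ 1 := by
        rw [← hnh]
        have : (j : ℝ) ≤ n := by exact_mod_cast (by omega : j ≤ n)
        exact mul_le_mul_of_nonneg_right this hhI.1
      have hzR := hYR β hβ _ ⟨hj0, hj1⟩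
      have hz : Y x β (j * h) ∈ K := by
        refine ⟨?_, hzR⟩
        have h2 := q2 _ hzR
        have h3 := dpp_le D hTcl hv hβ x hj0
        have h4 : j * h * ((2 * L + 3) * δ) ≤ 1 * ((2 * L + 3) * δ) := by gcongr
        have h5 := q1 x
        simp only [mem_setOf_eq]
        linarith
      obtain ⟨β', hβ', h2⟩ := step _ hz h hhI
      refine ⟨concat (j * h) β β', concat_relaxed hβ hβ' _, ?_⟩
      have e : ((j + 1 : ℕ) : ℝ) * h = j * h + h := by push_cast; ring
      rw [e, J_concat D hβ hβ' x hj0 hhI.1, Y_concat_right D.toDyn hβ hβ' x hj0 hhI.1]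
      linarith
  obtain ⟨β, hβ, h1⟩ := ind n le_rfl
  rw [hnh] at h1
  have h2 := q1 x
  have h3 := q2 (Y x β 1) (hYR β hβ 1 ⟨zero_le_one, le_rfl⟩)
  exact ⟨β, hβ, by linarith⟩

end Opt
end ExitTime

namespace ExitTime

section Weak

set_option linter.unusedSectionVars false

variable {N : ℕ} {A : Type*} [MetricSpace A] [CompactSpace A] [Nonempty A]
    [MeasurableSpace A] [BorelSpace A]

/-- the measure on `ℝ × A` generated by a relaxed control on the unit time interval -/
def joint {β : ℝ → Measure A} (hβ : IsRelaxedControl β) : Measure (ℝ × A) :=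
  (volume.restrict (Ioc (0:ℝ) 1)).compProd (ker hβ)

instance {β : ℝ → Measure A} (hβ : IsRelaxedControl β) : IsProbabilityMeasure (joint hβ) := by
  have : IsProbabilityMeasure (volume.restrict (Ioc (0:ℝ) 1)) := ⟨by simp⟩
  unfold joint
  infer_instance

theorem integral_joint {β : ℝ → Measure A} (hβ : IsRelaxedControl β) {φ : ℝ × A → ℝ}
    (hφ : Continuous φ) {C : ℝ} (hC : ∀ q, |φ q| ≤ C) :
    ∫ q, φ q ∂(joint hβ) = ∫ s in (0:ℝ)..1, ∫ a, φ (s, a) ∂(β s) := by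
  have hi : Integrable φ (joint hβ) :=
    Integrable.of_bound hφ.aestronglyMeasurable C (Eventually.of_forall hC)
  rw [intervalIntegral.integral_of_le zero_le_one]
  unfold joint at hi ⊢
  rw [Measure.integral_compProd hi]
  rfl

theorem joint_fst {β : ℝ → Measure A} (hβ : IsRelaxedControl β) :
    (joint hβ).fst = volume.restrict (Ioc (0:ℝ) 1) := by
  unfold joint
  exact Measure.fst_compProd _ _

theorem weak_limit (U : Ultrafilter ℕ) {b : ℕ → ℝ → Measure A} (hb : ∀ n, IsRelaxedControl (b n)) :
    ∃ β : ℝ → Measure A, IsRelaxedControl β ∧ ∀ φ : ℝ × A → ℝ, Continuous φ →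
      (∃ C, ∀ q, |φ q| ≤ C) →
      Tendsto (fun n => ∫ s in (0:ℝ)..1, ∫ a, φ (s, a) ∂(b n s)) U
        (𝓝 (∫ s in (0:ℝ)..1, ∫ a, φ (s, a) ∂(β s))) := by
  have hK : IsCompact (Icc (0:ℝ) 1 ×ˢ (univ : Set A)) := isCompact_Icc.prod isCompact_univ
  have hc := isCompact_setOfPred_finiteMeasure_le_of_isCompact 1 hK
  let F : ℕ → FiniteMeasure (ℝ × A) := fun n => ⟨joint (hb n), inferInstance⟩
  have hmem : ∀ n, F n ∈ {μ : FiniteMeasure (ℝ × A) | μ.mass ≤ 1 ∧ μ (Icc (0:ℝ) 1 ×ˢ (univ : Set A))ᶜ = 0} := by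
    intro n
    refine ⟨?_, ?_⟩
    · rw [← ENNReal.coe_le_coe, FiniteMeasure.ennreal_mass]
      change joint (hb n) univ ≤ 1
      exact prob_le_one
    · rw [FiniteMeasure.null_iff_toMeasure_null]
      change joint (hb n) _ = 0
      have e : ((Icc (0:ℝ) 1 ×ˢ (univ : Set A))ᶜ) = Prod.fst ⁻¹' (Icc (0:ℝ) 1)ᶜ := by
        ext q; simp
      rw [e, ← Measure.fst_apply measurableSet_Icc.compl, joint_fst,
        Measure.restrict_apply measurableSet_Icc.compl]
      have : (Icc (0:ℝ) 1)ᶜ ∩ Ioc 0 1 = ∅ := by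
        ext s
        simp only [mem_inter_iff, mem_compl_iff, mem_Icc, mem_Ioc, mem_empty_iff_false, iff_false]
        rintro ⟨h1, h2, h3⟩
        exact h1 ⟨h2.le, h3⟩
      rw [this, measure_empty]
  obtain ⟨μ, -, hμ⟩ := isCompact_iff_ultrafilter_le_nhds'.1 hc (U.map F)
    (by exact Filter.mem_map.2 (Filter.univ_mem' hmem))
  have hμt : Tendsto F U (𝓝 μ) := hμ
  rw [FiniteMeasure.tendsto_iff_forall_integral_tendsto] at hμt
  have hfst : (μ : Measure (ℝ × A)).fst = volume.restrict (Ioc (0:ℝ) 1) := by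
    have : IsProbabilityMeasure (volume.restrict (Ioc (0:ℝ) 1)) := ⟨by simp⟩
    refine ext_of_forall_integral_eq_of_IsFiniteMeasure fun g => ?_
    have h1 := hμt (g.compContinuous ⟨Prod.fst, continuous_fst⟩)
    have h2 : ∀ (ν : Measure (ℝ × A)), ∫ q, (g.compContinuous ⟨Prod.fst, continuous_fst⟩) q ∂ν
        = ∫ s, g s ∂ν.fst := by
      intro ν
      rw [Measure.fst, integral_map measurable_fst.aemeasurable
        g.continuous.aestronglyMeasurable]
      rfl
    simp only [h2] at h1
    have h3 : ∀ n, ((F n : FiniteMeasure (ℝ × A)) : Measure (ℝ × A)).fst =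
        volume.restrict (Ioc (0:ℝ) 1) := fun n => joint_fst (hb n)
    simp only [h3] at h1
    exact tendsto_nhds_unique h1 tendsto_const_nhds
  let κ := (μ : Measure (ℝ × A)).condKernel
  have hβ : IsRelaxedControl (fun s => κ s) := by
    refine ⟨fun s => inferInstance, fun g => ?_⟩
    have : StronglyMeasurable (fun q : ℝ × A => g q.2) :=
      (g.continuous.comp continuous_snd).stronglyMeasurable
    exact (this.integral_kernel_prod_right' (κ := κ)).measurable
  refine ⟨fun s => κ s, hβ, ?_⟩
  rintro φ hφ ⟨C, hC⟩
  have h1 := hμt (BoundedContinuousFunction.ofNormedAddCommGroup φ hφ C hC)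
  have h2 : (μ : Measure (ℝ × A)) = joint hβ := by
    conv_lhs => rw [← (μ : Measure (ℝ × A)).disintegrate (μ : Measure (ℝ × A)).condKernel]
    rw [hfst]
    rfl
  rw [h2] at h1
  have h3 : ∀ n, ∫ q, φ q ∂((F n : FiniteMeasure (ℝ × A)) : Measure (ℝ × A)) =
      ∫ s in (0:ℝ)..1, ∫ a, φ (s, a) ∂(b n s) := fun n => integral_joint (hb n) hφ hC
  have h4 := integral_joint hβ hφ hC
  rw [← h4]
  simp only [← h3]
  exact h1

/-- clamp to the unit interval -/
def clamp (s : ℝ) : ℝ := max 0 (min 1 s)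

theorem clamp_cont : Continuous clamp := by unfold clamp; fun_prop
theorem clamp_mem (s : ℝ) : clamp s ∈ Icc (0:ℝ) 1 := by
  unfold clamp; exact ⟨le_max_left _ _, max_le zero_le_one (min_le_left _ _)⟩
theorem clamp_of_mem {s : ℝ} (h : s ∈ Icc (0:ℝ) 1) : clamp s = s := by
  unfold clamp; rw [min_eq_right h.2, max_eq_right h.1]

/-- convergence of integrals up to time `t` -/
theorem weak_limit_t (U : Ultrafilter ℕ) {b : ℕ → ℝ → Measure A}
    (hb : ∀ n, IsRelaxedControl (b n)) {β : ℝ → Measure A} (hβ : IsRelaxedControl β)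
    (h : ∀ φ : ℝ × A → ℝ, Continuous φ → (∃ C, ∀ q, |φ q| ≤ C) →
      Tendsto (fun n => ∫ s in (0:ℝ)..1, ∫ a, φ (s, a) ∂(b n s)) U
        (𝓝 (∫ s in (0:ℝ)..1, ∫ a, φ (s, a) ∂(β s))))
    {φ : ℝ × A → ℝ} (hφ : Continuous φ) {t : ℝ} (ht : t ∈ Icc (0:ℝ) 1) :
    Tendsto (fun n => ∫ s in (0:ℝ)..t, ∫ a, φ (s, a) ∂(b n s)) U
        (𝓝 (∫ s in (0:ℝ)..t, ∫ a, φ (s, a) ∂(β s))) := by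
  have hK : IsCompact (Icc (0:ℝ) 1 ×ˢ (univ : Set A)) := isCompact_Icc.prod isCompact_univ
  obtain ⟨C₀, hC₀⟩ := hK.exists_bound_of_continuousOn hφ.continuousOn
  set C := max C₀ 1 with hCdef
  have hCpos : 0 < C := lt_of_lt_of_le one_pos (le_max_right _ _)
  have hC : ∀ s ∈ Icc (0:ℝ) 1, ∀ a, |φ (s, a)| ≤ C := fun s hs a =>
    (hC₀ (s, a) ⟨hs, mem_univ _⟩).trans (le_max_left _ _)
  rw [Metric.tendsto_nhds]
  intro ε hε
  set η := ε / (4 * C) with hη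
  have hηpos : 0 < η := by positivity
  -- cut-off
  set χ : ℝ → ℝ := fun s => max 0 (min 1 ((t + η - s) / η)) with hχ
  have hχc : Continuous χ := by rw [hχ]; fun_prop
  have hχ0 : ∀ s, 0 ≤ χ s := fun s => le_max_left _ _
  have hχ1 : ∀ s, χ s ≤ 1 := fun s => max_le zero_le_one (min_le_left _ _)
  have hχl : ∀ s, s ≤ t → χ s = 1 := by
    intro s hs
    have : 1 ≤ (t + η - s) / η := by rw [le_div_iff₀ hηpos]; linarith
    simp only [hχ, min_eq_left this]; norm_num
  have hχr : ∀ s, t + η ≤ s → χ s = 0 := by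
    intro s hs
    have : (t + η - s) / η ≤ 0 := div_nonpos_of_nonpos_of_nonneg (by linarith) hηpos.le
    exact max_eq_left ((min_le_right _ _).trans this)
  let ψ : ℝ × A → ℝ := fun q => χ q.1 * φ (clamp q.1, q.2)
  have hψ : Continuous ψ := (hχc.comp continuous_fst).mul
    (hφ.comp ((clamp_cont.comp continuous_fst).prodMk continuous_snd))
  have hψb : ∀ q, |ψ q| ≤ C := by
    intro q
    simp only [ψ, abs_mul, abs_of_nonneg (hχ0 q.1)]
    have := hC (clamp q.1) (clamp_mem _) q.2
    nlinarith [hχ1 q.1, hχ0 q.1, abs_nonneg (φ (clamp q.1, q.2))]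
  have key : ∀ γ : ℝ → Measure A, IsRelaxedControl γ →
      |(∫ s in (0:ℝ)..1, ∫ a, ψ (s, a) ∂(γ s)) - ∫ s in (0:ℝ)..t, ∫ a, φ (s, a) ∂(γ s)|
        ≤ C * η := by
    intro γ hγ
    have hp := hγ.1
    have e1 : ∫ s in (0:ℝ)..t, ∫ a, φ (s, a) ∂(γ s) = ∫ s in (0:ℝ)..t, ∫ a, ψ (s, a) ∂(γ s) := by
      refine intervalIntegral.integral_congr fun s hs => ?_
      rw [uIcc_of_le ht.1] at hs
      simp only [ψ, hχl s hs.2, clamp_of_mem ⟨hs.1, hs.2.trans ht.2⟩, one_mul]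
    rw [e1, intervalIntegral.integral_interval_sub_left (relaxed_ii hγ hψ 0 1) (relaxed_ii hγ hψ 0 t)]
    set r := max t (min 1 (t + η)) with hr
    have htr : t ≤ r := le_max_left _ _
    have hr1 : r ≤ 1 := max_le ht.2 (min_le_left _ _)
    rw [← intervalIntegral.integral_add_adjacent_intervals (relaxed_ii hγ hψ t r) (relaxed_ii hγ hψ r 1)]
    have z : ∫ s in r..1, ∫ a, ψ (s, a) ∂(γ s) = 0 := by
      have : ∫ s in r..1, ∫ a, ψ (s, a) ∂(γ s) = ∫ s in r..1, (0:ℝ) := by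
        refine intervalIntegral.integral_congr_ae (Eventually.of_forall fun s hs => ?_)
        rw [uIoc_of_le hr1] at hs
        have : t + η ≤ s := by
          rcases le_total 1 (t + η) with h1 | h1
          · have : r = 1 := by rw [hr, min_eq_left h1, max_eq_right ht.2]
            linarith [hs.1, hs.2]
          · have : min 1 (t + η) ≤ r := le_max_right _ _
            rw [min_eq_right h1] at this
            linarith [hs.1]
        simp [ψ, hχr s this]
      rw [this]; simp
    rw [z, add_zero]
    refine (intervalIntegral.norm_integral_le_of_norm_le_const (C := C) (fun s _ =>
      rel_bound (γ s) (g := fun a => ψ (s, a)) fun a => hψb (s, a))).trans ?_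
    rw [abs_of_nonneg (by linarith)]
    have : r ≤ t + η := max_le (by linarith) (min_le_right _ _)
    nlinarith
  have hlim := Metric.tendsto_nhds.1 (h ψ hψ ⟨C, hψb⟩) (ε / 2) (by positivity)
  filter_upwards [hlim] with n hn
  have k1 := key _ (hb n)
  have k2 := key _ hβ
  have k3 : C * η = ε / 4 := by rw [hη]; field_simp
  rw [Real.dist_eq] at hn ⊢
  rw [k3] at k1 k2
  rw [abs_le] at k1 k2
  rw [abs_lt] at hn ⊢
  constructor <;> linarith [k1.1, k1.2, k2.1, k2.2, hn.1, hn.2]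

end Weak

end ExitTime

namespace ExitTime

section Compact

set_option linter.unusedSectionVars false

variable {N : ℕ} {A : Type*} [MetricSpace A] [CompactSpace A] [Nonempty A]
    [MeasurableSpace A] [BorelSpace A]
variable {f : Eu N → A → Eu N} {L : ℝ} {Y : Eu N → (ℝ → Measure A) → ℝ → Eu N}
  {ℓ : Eu N → A → ℝ} {T : Set (Eu N)} {vR : Eu N → ℝ}

theorem proj_rel (i : Fin N) {γ : ℝ → Measure A} (hγ : IsRelaxedControl γ) {φ : ℝ × A → Eu N}
    (hφ : Continuous φ) (t : ℝ) :
    (∫ s in (0:ℝ)..t, ∫ a, φ (s, a) ∂(γ s)) i = ∫ s in (0:ℝ)..t, ∫ a, φ (s, a) i ∂(γ s) := by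
  have hp := hγ.1
  have h1 := (EuclideanSpace.proj (𝕜 := ℝ) i : Eu N →L[ℝ] ℝ).intervalIntegral_comp_comm (relaxed_ii hγ hφ 0 t)
  have h2 : ∀ s, ∫ a, φ (s, a) i ∂(γ s) = (EuclideanSpace.proj (𝕜 := ℝ) i : Eu N →L[ℝ] ℝ) (∫ a, φ (s, a) ∂(γ s)) := by
    intro s
    exact (EuclideanSpace.proj (𝕜 := ℝ) i : Eu N →L[ℝ] ℝ).integral_comp_comm
      (cont_integrable (γ s) (hφ.comp (continuous_const.prodMk continuous_id)))
  simp only [h2]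
  exact h1.symm

theorem weak_limit_vec (U : Ultrafilter ℕ) {b : ℕ → ℝ → Measure A}
    (hb : ∀ n, IsRelaxedControl (b n)) {β : ℝ → Measure A} (hβ : IsRelaxedControl β)
    (h : ∀ φ : ℝ × A → ℝ, Continuous φ → (∃ C, ∀ q, |φ q| ≤ C) →
      Tendsto (fun n => ∫ s in (0:ℝ)..1, ∫ a, φ (s, a) ∂(b n s)) U
        (𝓝 (∫ s in (0:ℝ)..1, ∫ a, φ (s, a) ∂(β s))))
    {φ : ℝ × A → Eu N} (hφ : Continuous φ) {t : ℝ} (ht : t ∈ Icc (0:ℝ) 1) :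
    Tendsto (fun n => ∫ s in (0:ℝ)..t, ∫ a, φ (s, a) ∂(b n s)) U
        (𝓝 (∫ s in (0:ℝ)..t, ∫ a, φ (s, a) ∂(β s))) := by
  rw [(PiLp.homeomorph 2 (fun _ : Fin N => ℝ)).isInducing.tendsto_nhds_iff, tendsto_pi_nhds]
  intro i
  have hi : Continuous fun q : ℝ × A => φ q i := (EuclideanSpace.proj (𝕜 := ℝ) i : Eu N →L[ℝ] ℝ).continuous.comp hφ
  have := weak_limit_t U hb hβ h hi ht
  have e1 := fun n => proj_rel i (hb n) hφ t
  have e2 := proj_rel i hβ hφ t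
  simp only [← e1, ← e2] at this
  exact this

/-- uniform convergence of the integrals along the ultrafilter -/
theorem weak_limit_unif (U : Ultrafilter ℕ) {b : ℕ → ℝ → Measure A}
    (hb : ∀ n, IsRelaxedControl (b n)) {β : ℝ → Measure A} (hβ : IsRelaxedControl β)
    (h : ∀ φ : ℝ × A → ℝ, Continuous φ → (∃ C, ∀ q, |φ q| ≤ C) →
      Tendsto (fun n => ∫ s in (0:ℝ)..1, ∫ a, φ (s, a) ∂(b n s)) U
        (𝓝 (∫ s in (0:ℝ)..1, ∫ a, φ (s, a) ∂(β s))))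
    {φ : ℝ × A → Eu N} (hφ : Continuous φ) {ε : ℝ} (hε : 0 < ε) :
    ∀ᶠ n in (U : Filter ℕ), ∀ t ∈ Icc (0:ℝ) 1,
      ‖(∫ s in (0:ℝ)..t, ∫ a, φ (s, a) ∂(b n s)) - ∫ s in (0:ℝ)..t, ∫ a, φ (s, a) ∂(β s)‖ ≤ ε := by
  have hK : IsCompact (Icc (0:ℝ) 1 ×ˢ (univ : Set A)) := isCompact_Icc.prod isCompact_univ
  obtain ⟨C₀, hC₀⟩ := hK.exists_bound_of_continuousOn hφ.continuousOn
  set C := max C₀ 1 with hCdef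
  have hCpos : 0 < C := lt_of_lt_of_le one_pos (le_max_right _ _)
  have hC : ∀ s ∈ Icc (0:ℝ) 1, ∀ a, ‖φ (s, a)‖ ≤ C := fun s hs a =>
    (hC₀ (s, a) ⟨hs, mem_univ _⟩).trans (le_max_left _ _)
  have lip : ∀ γ : ℝ → Measure A, IsRelaxedControl γ → ∀ t ∈ Icc (0:ℝ) 1, ∀ r ∈ Icc (0:ℝ) 1,
      ‖(∫ s in (0:ℝ)..t, ∫ a, φ (s, a) ∂(γ s)) - ∫ s in (0:ℝ)..r, ∫ a, φ (s, a) ∂(γ s)‖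
        ≤ C * |t - r| := by
    intro γ hγ t ht r hr
    have hp := hγ.1
    rw [intervalIntegral.integral_interval_sub_left (relaxed_ii hγ hφ 0 t) (relaxed_ii hγ hφ 0 r)]
    refine intervalIntegral.norm_integral_le_of_norm_le_const fun s hs => ?_
    refine rel_bound (γ s) (g := fun a => φ (s, a)) fun a => hC s ?_ a
    have := uIoc_subset_uIcc hs
    exact uIcc_subset_Icc hr ht this
  set ρ := ε / (4 * C) with hρ
  have hρpos : 0 < ρ := by positivity
  obtain ⟨S, hSsub, hSfin, hScov⟩ := (isCompact_Icc (a := (0:ℝ)) (b := 1)).finite_cover_balls hρpos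
  have hpt : ∀ᶠ n in (U : Filter ℕ), ∀ r ∈ S,
      ‖(∫ s in (0:ℝ)..r, ∫ a, φ (s, a) ∂(b n s)) - ∫ s in (0:ℝ)..r, ∫ a, φ (s, a) ∂(β s)‖ < ε / 2 := by
    rw [eventually_all_finite hSfin]
    intro r hr
    have := Metric.tendsto_nhds.1 (weak_limit_vec U hb hβ h hφ (hSsub hr)) (ε / 2) (by positivity)
    simpa only [dist_eq_norm] using this
  filter_upwards [hpt] with n hn t ht
  obtain ⟨r, hr, htr⟩ := mem_iUnion₂.1 (hScov ht)
  have l1 := lip _ (hb n) t ht r (hSsub hr)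
  have l2 := lip _ hβ t ht r (hSsub hr)
  have l3 := hn r hr
  rw [mem_ball, Real.dist_eq] at htr
  have k3 : C * ρ = ε / 4 := by rw [hρ]; field_simp
  have l4 : C * |t - r| ≤ ε / 4 := by rw [← k3]; gcongr
  set a1 := ∫ s in (0:ℝ)..t, ∫ a, φ (s, a) ∂(b n s)
  set a2 := ∫ s in (0:ℝ)..t, ∫ a, φ (s, a) ∂(β s)
  set b1 := ∫ s in (0:ℝ)..r, ∫ a, φ (s, a) ∂(b n s)
  set b2 := ∫ s in (0:ℝ)..r, ∫ a, φ (s, a) ∂(β s)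
  have e : a1 - a2 = (a1 - b1) + (b1 - b2) - (a2 - b2) := by abel
  rw [e]
  have := norm_sub_le ((a1 - b1) + (b1 - b2)) (a2 - b2)
  have := norm_add_le (a1 - b1) (b1 - b2)
  linarith

theorem traj_conv (D : Setup f L Y ℓ) (U : Ultrafilter ℕ) {b : ℕ → ℝ → Measure A}
    (hb : ∀ n, IsRelaxedControl (b n)) {β : ℝ → Measure A} (hβ : IsRelaxedControl β)
    (h : ∀ φ : ℝ × A → ℝ, Continuous φ → (∃ C, ∀ q, |φ q| ≤ C) →
      Tendsto (fun n => ∫ s in (0:ℝ)..1, ∫ a, φ (s, a) ∂(b n s)) U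
        (𝓝 (∫ s in (0:ℝ)..1, ∫ a, φ (s, a) ∂(β s))))
    {z : ℕ → Eu N} {x : Eu N} (hz : Tendsto z U (𝓝 x)) {ε : ℝ} (hε : 0 < ε) :
    ∀ᶠ n in (U : Filter ℕ), ∀ t ∈ Icc (0:ℝ) 1, ‖Y (z n) (b n) t - Y x β t‖ ≤ ε := by
  have hL := D.hL
  set δ := ε / (2 * Real.exp L) with hδ
  have hδpos : 0 < δ := by positivity
  have hφ := cont_comp D.hf (D.Yc hβ x)
  filter_upwards [weak_limit_unif U hb hβ h hφ hδpos, Metric.tendsto_nhds.1 hz δ hδpos] with n hn hzn t ht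
  have hc := D.Yc (hb n) (z n)
  have hp := (hb n).1
  have hu : Continuous fun t => ‖Y (z n) (b n) t - Y x β t‖ := (hc.sub (D.Yc hβ x)).norm
  have key := gronwall_int hu (c := 2 * δ) (L := L) (t₀ := 1) hL.le ?_ t ht
  · refine key.trans ?_
    have : Real.exp (L * t) ≤ Real.exp L := Real.exp_le_exp.2 (by nlinarith [ht.2])
    have e : 2 * δ * Real.exp L = ε := by rw [hδ]; field_simp
    rw [← e]; gcongr
  · intro t ht
    rw [(D.hY _ _ (hb n)).2.2 t ht.1, (D.hY _ _ hβ).2.2 t ht.1]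
    set I1 := ∫ s in (0:ℝ)..t, ∫ a, f (Y (z n) (b n) s) a ∂(b n s)
    set I2 := ∫ s in (0:ℝ)..t, ∫ a, f (Y x β s) a ∂(β s)
    set I3 := ∫ s in (0:ℝ)..t, ∫ a, f (Y x β s) a ∂(b n s) with hI3
    have a1 : ‖I3 - I2‖ ≤ δ := hn t ht
    have a2 : ‖I1 - I3‖ ≤ L * ∫ s in (0:ℝ)..t, ‖Y (z n) (b n) s - Y x β s‖ := by
      rw [← intervalIntegral.integral_sub (rel_ii D.hf (hb n) hc 0 t) (rel_ii D.hf (hb n) (D.Yc hβ x) 0 t),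
        ← intervalIntegral.integral_const_mul]
      refine intervalIntegral.norm_integral_le_of_norm_le ht.1 (Eventually.of_forall fun s _ =>
        rel_lip D.hf D.hfLip (b n s) _ _) ((hu.const_smul L).intervalIntegrable _ _)
    have a3 : ‖z n - x‖ < δ := by rwa [dist_eq_norm] at hzn
    have e : z n + I1 - (x + I2) = (z n - x) + (I3 - I2) + (I1 - I3) := by abel
    rw [e]
    have := norm_add_le ((z n - x) + (I3 - I2)) (I1 - I3)
    have := norm_add_le (z n - x) (I3 - I2)
    linarith

theorem cost_lower (D : Setup f L Y ℓ)
    (hH5 : ∀ t > (0:ℝ), ∀ β, IsRelaxedControl β → ∀ x ∉ T, 0 < runCost ℓ β (Y x β) t)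
    {K : Set (Eu N)} (hK : IsCompact K) (hKT : K ⊆ Tᶜ) :
    ∃ c > 0, ∀ x ∈ K, ∀ β, IsRelaxedControl β → c ≤ J ℓ Y x β 1 := by
  by_contra hcon
  push Not at hcon
  have hpos : ∀ n : ℕ, (0:ℝ) < 1 / ((n:ℝ) + 1) := fun n => Nat.one_div_pos_of_nat
  choose z hzK b hb hJ using fun n : ℕ => hcon _ (hpos n)
  let U : Ultrafilter ℕ := hyperfilter ℕ
  obtain ⟨x, hxK, hx⟩ := isCompact_iff_ultrafilter_le_nhds'.1 hK (U.map z)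
    (by exact Filter.mem_map.2 (Filter.univ_mem' hzK))
  have hz : Tendsto z U (𝓝 x) := hx
  obtain ⟨β, hβ, h⟩ := weak_limit U hb
  have hconv := fun {ε : ℝ} (hε : 0 < ε) => traj_conv D U hb hβ h hz hε
  have hJ0 : J ℓ Y x β 1 ≤ 0 := by
    refine le_of_forall_pos_le_add fun ε hε => ?_
    rw [zero_add]
    obtain ⟨R₀, hR₀⟩ := (isCompact_Icc (a := (0:ℝ)) (b := 1)).exists_bound_of_continuousOn
      (D.Yc hβ x).continuousOn
    obtain ⟨ρ, hρ, hu⟩ := unif_ball D.hℓ (R₀ + 1) (δ := ε / 3) (by positivity)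
    have h1 := hconv (ε := min ρ 1) (by positivity)
    have h2 := Metric.tendsto_nhds.1 (weak_limit_t U hb hβ h (cont_comp D.hℓ (D.Yc hβ x))
      (t := 1) (by simp)) (ε / 3) (by positivity)
    have h3 : ∀ᶠ n : ℕ in (U : Filter ℕ), 1 / ((n:ℝ) + 1) < ε / 3 := by
      have : Tendsto (fun n : ℕ => 1 / ((n:ℝ) + 1)) U (𝓝 0) :=
        tendsto_one_div_add_atTop_nhds_zero_nat.mono_left (Nat.hyperfilter_le_atTop)
      exact this.eventually_lt_const (by positivity)
    obtain ⟨n, hn1, hn2, hn3⟩ := (h1.and (h2.and h3)).exists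
    have hp := (hb n).1
    rw [Real.dist_eq] at hn2
    have h4 : |(∫ s in (0:ℝ)..1, ∫ a, ℓ (Y x β s) a ∂(b n s)) - J ℓ Y (z n) (b n) 1| ≤ ε / 3 := by
      unfold J
      rw [← intervalIntegral.integral_sub (rel_ii D.hℓ (hb n) (D.Yc hβ x) 0 1)
        (rel_ii D.hℓ (hb n) (D.Yc (hb n) (z n)) 0 1)]
      have hle : ∀ s ∈ uIoc (0:ℝ) 1, ‖(∫ a, ℓ (Y x β s) a ∂(b n s)) -
          ∫ a, ℓ (Y (z n) (b n) s) a ∂(b n s)‖ ≤ ε / 3 := ?_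
      · have := intervalIntegral.norm_integral_le_of_norm_le_const hle
        rw [sub_zero, abs_one, mul_one] at this
        exact this
      intro s hs
      rw [uIoc_of_le zero_le_one] at hs
      have hs' : s ∈ Icc (0:ℝ) 1 := ⟨hs.1.le, hs.2⟩
      rw [← integral_sub (cont_integrable (b n s) (cont_slice D.hℓ _))
        (cont_integrable (b n s) (cont_slice D.hℓ _))]
      have q1 := hn1 s hs'
      have q2 := hR₀ s hs'
      refine rel_bound (b n s) fun a => ?_
      refine hu _ ?_ _ ?_ ?_ a
      · rw [mem_closedBall_zero_iff]; linarith
      · rw [mem_closedBall_zero_iff]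
        have := norm_le_insert' (Y (z n) (b n) s) (Y x β s)
        linarith [min_le_right ρ 1]
      · rw [norm_sub_rev]; exact q1.trans (min_le_left _ _)
    have h5 := hJ n
    have h6 : J ℓ Y x β 1 = ∫ s in (0:ℝ)..1, ∫ a, ℓ (Y x β s) a ∂(β s) := rfl
    rw [← h6] at hn2
    rw [abs_lt] at hn2
    rw [abs_le] at h4
    linarith [hn2.1, hn2.2, h4.1, h4.2]
  have := hH5 1 one_pos β hβ x (hKT hxK)
  rw [runCost_eq D hβ x zero_le_one, ENNReal.ofReal_of_nonpos hJ0] at this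
  exact lt_irrefl _ this

end Compact

end ExitTime

namespace ExitTime

section Final

set_option linter.unusedSectionVars false

variable {N : ℕ} {A : Type*} [MetricSpace A] [CompactSpace A] [Nonempty A]
    [MeasurableSpace A] [BorelSpace A]
variable {f : Eu N → A → Eu N} {L : ℝ} {Y : Eu N → (ℝ → Measure A) → ℝ → Eu N}
  {ℓ : Eu N → A → ℝ} {T : Set (Eu N)} {vR : Eu N → ℝ}

/-- countable concatenation of controls of unit length -/
def glue (c : ℕ → ℝ → Measure A) : ℝ → Measure A :=
  fun s => c (⌈s⌉₊ - 1) (s - ((⌈s⌉₊ - 1 : ℕ) : ℝ))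

theorem glue_relaxed {c : ℕ → ℝ → Measure A} (hc : ∀ k, IsRelaxedControl (c k)) :
    IsRelaxedControl (glue c) := by
  refine ⟨fun s => (hc _).1 _, fun g => ?_⟩
  have hF : Measurable (fun q : ℕ × ℝ => ∫ a, g a ∂(c q.1 (q.2 - (q.1 : ℝ)))) :=
    measurable_from_prod_countable_right fun k => ((hc k).2 g).comp (measurable_id.sub_const (k:ℝ))
  have hk : Measurable fun s : ℝ => ⌈s⌉₊ - 1 :=
    (measurable_from_nat (f := fun n : ℕ => n - 1)).comp Nat.measurable_ceil
  exact hF.comp (hk.prodMk measurable_id)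

theorem glue_eq (c : ℕ → ℝ → Measure A) (k : ℕ) : ∀ s ∈ Ioc (0:ℝ) 1,
    shift (k:ℝ) (glue c) s = c k s := by
  intro s hs
  have : ⌈(k:ℝ) + s⌉₊ = k + 1 := by
    rw [Nat.ceil_eq_iff (by omega)]
    simp only [Nat.add_sub_cancel, Nat.cast_add, Nat.cast_one]
    constructor <;> linarith [hs.1, hs.2]
  simp [shift, glue, this]

theorem glue_traj (D : Setup f L Y ℓ) {c : ℕ → ℝ → Measure A} (hc : ∀ k, IsRelaxedControl (c k))
    {X : ℕ → Eu N} (hX : ∀ k, X (k + 1) = Y (X k) (c k) 1) (k : ℕ) :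
    Y (X 0) (glue c) k = X k ∧
      J ℓ Y (X 0) (glue c) k = ∑ j ∈ Finset.range k, J ℓ Y (X j) (c j) 1 := by
  have hg := glue_relaxed hc
  induction k with
  | zero => simp [D.Y0 hg, J]
  | succ k ih =>
    push_cast
    have hk : (0:ℝ) ≤ k := by positivity
    rw [Y_shift D.toDyn hg _ hk zero_le_one, J_add D hg _ hk zero_le_one, ih.1, ih.2,
      Finset.sum_range_succ, hX]
    refine ⟨Y_congr D.toDyn (shift_relaxed hg _) (hc k) _ (t₀ := 1) (glue_eq c k) 1 (by simp), ?_⟩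
    rw [J_congr D (shift_relaxed hg _) (hc k) _ zero_le_one (glue_eq c k)]

theorem le_val (D : Setup f L Y ℓ) (hTcl : IsClosed T)
    (hv : ∀ x, valueFn T ℓ Y x = (vR x : EReal)) {w : Eu N → ℝ} (hw : Continuous w)
    (hwT : ∀ x ∈ T, w x = 0) (hsol : IsViscositySol (HJB f ℓ) Tᶜ w) (x : Eu N) : w x ≤ vR x := by
  refine le_of_forall_pos_le_add fun ε hε => ?_
  obtain ⟨β, t, hβ, ht, hT, hnT, hJ⟩ := val_approx D hTcl hv x hε
  rcases ht.eq_or_lt with rfl | ht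
  · rw [D.Y0 hβ] at hT
    rw [hwT x hT]
    linarith [val_nonneg D hTcl hv x]
  have h1 : ∀ s ∈ Ico 0 t, w x ≤ J ℓ Y x β t + w (Y x β s) := by
    intro s hs
    have := sub_opt D hTcl hw hsol hβ x hs.1 fun r hr => hnT r ⟨hr.1, hr.2.trans_lt hs.2⟩
    linarith [J_mono D hβ x hs.1 hs.2.le]
  have h2 : Tendsto (fun s => J ℓ Y x β t + w (Y x β s)) (𝓝[<] t) (𝓝 (J ℓ Y x β t + w (Y x β t))) :=
    ((continuous_const.add (hw.comp (D.Yc hβ x))).tendsto t).mono_left nhdsWithin_le_nhds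
  have h3 := ge_of_tendsto h2 (b := w x) (by
    filter_upwards [Ico_mem_nhdsLT ht] with s hs using h1 s hs)
  rw [hwT _ hT] at h3
  linarith

theorem val_le_sol (D : Setup f L Y ℓ) (hTcl : IsClosed T)
    (hv : ∀ x, valueFn T ℓ Y x = (vR x : EReal)) (hvc : Continuous vR)
    (hH5 : ∀ t > (0:ℝ), ∀ β, IsRelaxedControl β → ∀ x ∉ T, 0 < runCost ℓ β (Y x β) t)
    (hH6 : ∀ x β, IsRelaxedControl β →
        (∀ M : ℝ, ∀ t : ℝ, ∃ s, t ≤ s ∧ M < ‖Y x β s‖) →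
        (∫⁻ s in Ioi (0:ℝ), ENNReal.ofReal (∫ a, ℓ (Y x β s) a ∂(β s))) = ⊤)
    {w : Eu N → ℝ} (hw : Continuous w)
    (hwT : ∀ x ∈ T, w x = 0) (hsol : IsViscositySol (HJB f ℓ) Tᶜ w) (hwb : BddBelow (range w))
    (x : Eu N) : vR x ≤ w x := by
  by_contra hcon
  push Not at hcon
  obtain ⟨m, hm⟩ := hwb
  have hm : ∀ z, m ≤ w z := fun z => hm ⟨z, rfl⟩
  set η := (vR x - w x) / 3 with hη
  have hηpos : 0 < η := by rw [hη]; linarith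
  set δ : ℕ → ℝ := fun k => η / 2 ^ (k + 1) with hδ
  have hδpos : ∀ k, 0 < δ k := fun k => by simp only [hδ]; positivity
  have hex : ∀ (z : Eu N) (d : ℝ), ∃ β, IsRelaxedControl β ∧ (0 < d → 2 * η + d ≤ vR z - w z →
      w (Y z β 1) + J ℓ Y z β 1 ≤ w z + d) := by
    intro z d
    by_cases h : 0 < d ∧ 2 * η + d ≤ vR z - w z
    · obtain ⟨β, hβ, h1⟩ := sup_opt D hTcl hv hvc hw hwT hsol (η := 2 * η) (by positivity) h.1 z h.2
      exact ⟨β, hβ, fun _ _ => h1⟩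
    · obtain ⟨a⟩ := ‹Nonempty A›
      exact ⟨_, const_relaxed (Measure.dirac a), fun h1 h2 => absurd ⟨h1, h2⟩ h⟩
  choose b hb hbJ using hex
  let X : ℕ → Eu N := fun k => Nat.rec x (fun k z => Y z (b z (δ k)) 1) k
  let c : ℕ → ℝ → Measure A := fun k => b (X k) (δ k)
  have hc : ∀ k, IsRelaxedControl (c k) := fun k => hb _ _
  have hX : ∀ k, X (k + 1) = Y (X k) (c k) 1 := fun k => rfl
  have hinv : ∀ k, 2 * η + η / 2 ^ k ≤ vR (X k) - w (X k) ∧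
      w (X k) + ∑ j ∈ Finset.range k, J ℓ Y (X j) (c j) 1 ≤ w x + η - η / 2 ^ k := by
    intro k
    induction k with
    | zero =>
      have : X 0 = x := rfl
      simp only [this, pow_zero, div_one, Finset.range_zero, Finset.sum_empty]
      constructor <;> linarith
    | succ k ih =>
      have hhalf : η / 2 ^ k = δ k + δ k := by
        simp only [hδ, pow_succ]; field_simp; norm_num
      have e : η / 2 ^ (k + 1) = δ k := rfl
      have h1 : w (X (k+1)) + J ℓ Y (X k) (c k) 1 ≤ w (X k) + δ k := hbJ (X k) (δ k) (hδpos k) (by linarith [ih.1, hδpos k])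
      have h2 : vR (X k) ≤ J ℓ Y (X k) (c k) 1 + vR (X (k+1)) := dpp_le D hTcl hv (hc k) (X k) zero_le_one
      rw [Finset.sum_range_succ, e]
      constructor <;> linarith [ih.1, ih.2]
  have hgl := glue_traj D hc hX
  have hg := glue_relaxed hc
  have hX0 : X 0 = x := rfl
  set B := glue c with hB
  set C := w x + η - m with hC
  have hS : ∀ k : ℕ, J ℓ Y x B k ≤ C := by
    intro k
    have h1 := (hgl k).2
    rw [hX0] at h1
    rw [h1]
    have := (hinv k).2
    have h3 : 0 ≤ η / 2 ^ k := by positivity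
    linarith [hm (X k)]
  have hfin : (∫⁻ s in Ioi (0:ℝ), ENNReal.ofReal (∫ a, ℓ (Y x B s) a ∂(B s))) ≠ ⊤ := by
    have hle : (∫⁻ s in Ioi (0:ℝ), ENNReal.ofReal (∫ a, ℓ (Y x B s) a ∂(B s))) ≤ ENNReal.ofReal C := by
      have hU : Ioi (0:ℝ) = ⋃ k : ℕ, Ioc (0:ℝ) k := by
        ext s
        simp only [mem_Ioi, mem_iUnion, mem_Ioc]
        exact ⟨fun h => (exists_nat_ge s).imp fun k hk => ⟨h, hk⟩, fun ⟨k, hk⟩ => hk.1⟩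
      have hmono : Monotone fun k : ℕ => Ioc (0:ℝ) k := fun i j hij =>
        Ioc_subset_Ioc_right (by exact_mod_cast hij)
      rw [hU, setLIntegral_iUnion_of_directed _ hmono.directed_le]
      refine iSup_le fun k => ?_
      have := runCost_eq D hg x (t := (k:ℝ)) (by positivity)
      unfold runCost at this
      rw [this]
      exact ENNReal.ofReal_le_ofReal (hS k)
    exact ne_top_of_le_ne_top ENNReal.ofReal_ne_top hle
  have hbd : ∃ M t : ℝ, ∀ s, t ≤ s → ‖Y x B s‖ ≤ M := by
    by_contra h
    push Not at h
    exact hfin (hH6 x B hg h)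
  obtain ⟨M, t, hM⟩ := hbd
  set K : Set (Eu N) := {z | η ≤ vR z - w z} ∩ closedBall 0 M with hKdef
  have hK : IsCompact K := (isCompact_closedBall _ _).inter_left
    (isClosed_le continuous_const (hvc.sub hw))
  have hKT : K ⊆ Tᶜ := by
    intro z hz hzT
    have h1 : η ≤ vR z - w z := hz.1
    rw [val_zero D hTcl hv hzT, hwT z hzT] at h1
    linarith
  obtain ⟨e, he, hlow⟩ := cost_lower D hH5 hK hKT
  obtain ⟨n₀, hn₀⟩ := exists_nat_ge t
  have hXK : ∀ k, n₀ ≤ k → X k ∈ K := by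
    intro k hk
    refine ⟨?_, ?_⟩
    · have h3 : 0 ≤ η / 2 ^ k := by positivity
      change η ≤ vR (X k) - w (X k)
      linarith [(hinv k).1]
    · rw [mem_closedBall_zero_iff, ← (hgl k).1]
      exact hM _ (hn₀.trans (by exact_mod_cast hk))
  have hgrow : ∀ j : ℕ, j * e ≤ ∑ i ∈ Finset.range (n₀ + j), J ℓ Y (X i) (c i) 1 := by
    intro j
    induction j with
    | zero =>
      simp only [Nat.cast_zero, zero_mul]
      exact Finset.sum_nonneg fun i _ => J_nonneg D _ _ zero_le_one
    | succ j ih =>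
      rw [← add_assoc, Finset.sum_range_succ]
      push_cast
      have := hlow (X (n₀ + j)) (hXK _ (by omega)) _ (hc (n₀ + j))
      linarith
  obtain ⟨j, hj⟩ := exists_nat_gt (C / e)
  have h1 := hgrow j
  have h2 := hS (n₀ + j)
  have h3 := (hgl (n₀ + j)).2
  rw [hX0] at h3
  rw [h3] at h2
  rw [div_lt_iff₀ he] at hj
  linarith

end Final

end ExitTime

/-- if the value function `v` is finite and continuous (represented by the
real-valued continuous function `vR` with `vR = v`), then `v` is a viscosity solution of
the HJBE on `ℝ^N ∖ T`, is bounded from below, vanishes on `T`, and is the unique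
continuous bounded-from-below viscosity solution of the HJBE vanishing on `T`. -/
theorem value_is_unique_solution {N : ℕ} {A : Type*} [MetricSpace A] [CompactSpace A]
    [Nonempty A] [MeasurableSpace A] [BorelSpace A]
    (T : Set (EuclideanSpace ℝ (Fin N))) (hTcl : IsClosed T) (hTne : T.Nonempty)
    (f : EuclideanSpace ℝ (Fin N) → A → EuclideanSpace ℝ (Fin N))
    (hf : Continuous fun q : EuclideanSpace ℝ (Fin N) × A => f q.1 q.2)
    (L : ℝ) (hL : 0 < L)
    (hfLip : ∀ x y a, ‖f x a - f y a‖ ≤ L * ‖x - y‖)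
    (ℓ : EuclideanSpace ℝ (Fin N) → A → ℝ)
    (hℓ : Continuous fun q : EuclideanSpace ℝ (Fin N) × A => ℓ q.1 q.2)
    (hℓnn : ∀ x a, 0 ≤ ℓ x a)
    (Y : EuclideanSpace ℝ (Fin N) → (ℝ → Measure A) → ℝ → EuclideanSpace ℝ (Fin N))
    (hY : ∀ x β, IsRelaxedControl β → IsTrajectory f β x (Y x β))
    (hSTC : ∀ ε > (0:ℝ), T ⊆ interior {x | ∃ t, 0 ≤ t ∧ t < ε ∧
        ∃ β, IsRelaxedControl β ∧ Y x β t ∈ T})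
    (hH5 : ∀ t > (0:ℝ), ∀ β, IsRelaxedControl β → ∀ x ∉ T,
        0 < runCost ℓ β (Y x β) t)
    (hH6 : ∀ x β, IsRelaxedControl β →
        (∀ M : ℝ, ∀ t : ℝ, ∃ s, t ≤ s ∧ M < ‖Y x β s‖) →
        (∫⁻ s in Ioi (0:ℝ), ENNReal.ofReal (∫ a, ℓ (Y x β s) a ∂(β s))) = ⊤)
    -- `v` is finite and continuous: it is (the coercion of) a continuous real function
    (vR : EuclideanSpace ℝ (Fin N) → ℝ) (hvR : Continuous vR)
    (hvfin : ∀ x, valueFn T ℓ Y x = (vR x : EReal)) :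
    IsViscositySol (HJB f ℓ) Tᶜ vR ∧ BddBelow (range vR) ∧ (∀ x ∈ T, vR x = 0) ∧
      ∀ w : EuclideanSpace ℝ (Fin N) → ℝ, Continuous w →
        IsViscositySol (HJB f ℓ) Tᶜ w → BddBelow (range w) → (∀ x ∈ T, w x = 0) →
        w = vR := by
  have D : ExitTime.Setup f L Y ℓ := ⟨⟨hf, hL, hfLip, hY⟩, hℓ, hℓnn⟩
  refine ⟨ExitTime.val_viscosity D hTcl hvfin, ⟨0, ?_⟩, fun x hx =>
    ExitTime.val_zero D hTcl hvfin hx, ?_⟩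
  · rintro _ ⟨x, rfl⟩
    exact ExitTime.val_nonneg D hTcl hvfin x
  · intro w hw hsol hwb hwT
    funext x
    exact le_antisymm (ExitTime.le_val D hTcl hvfin hw hwT hsol x)
      (ExitTime.val_le_sol D hTcl hvfin hvR hH5 hH6 hw hwT hsol hwb x)
end
end

section
/- Assume the relaxed-control exit-time setup (no target hypotheses needed). Let E ⊂ ℝ^N be bounded and open, and let u be continuous on the closure of E and a viscosity solution of H(x,Du(x)) = 0 on E, where H(x,p) := sup_{a ∈ A} { −f(x,a)·p − ℓ(x,a) }. For q ∈ E and β ∈ 𝒜 set τ_q(β) := inf{t ≥ 0 : y_q(t,β) ∈ ∂E}. Then for all β ∈ 𝒜, q ∈ E, and 0 ≤ δ < τ_q(β), one has u(q) ≤ ∫₀^δ ℓ^r(y_q(s,β),β(s)) ds + u(y_q(δ,β)); moreover the same inequality holds with δ = τ_q(β) whenever τ_q(β) < ∞. -/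
open MeasureTheory Set Filter Topology Metric
open scoped RealInnerProductSpace ENNReal

noncomputable section

/-- Carathéodory-type measurability, scalar case. -/
lemma aux_meas {N : ℕ} {A : Type*} [MetricSpace A] [CompactSpace A]
    [MeasurableSpace A] [BorelSpace A]
    (g : EuclideanSpace ℝ (Fin N) → A → ℝ)
    (hg : Continuous fun q : EuclideanSpace ℝ (Fin N) × A => g q.1 q.2)
    (β : ℝ → Measure A) (hβ : IsRelaxedControl β)
    (y : ℝ → EuclideanSpace ℝ (Fin N)) (hy : Continuous y) :
    Measurable fun s => ∫ a, g (y s) a ∂(β s) := by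
  have h1 : Measurable (Function.uncurry
      (fun (x : EuclideanSpace ℝ (Fin N)) (t : ℝ) => ∫ a, g x a ∂(β t))) := by
    apply measurable_uncurry_of_continuous_of_measurable
    · intro t
      have := hβ.1 t
      have h := continuous_parametric_integral_of_continuous (μ := β t) (f := g) hg
        (isCompact_univ (X := A))
      simpa using h
    · intro x
      exact hβ.2 ⟨fun a => g x a, by fun_prop⟩
  exact h1.comp (hy.measurable.prodMk measurable_id)

lemma aux_integrable {N : ℕ} {A : Type*} [MetricSpace A] [CompactSpace A]
    [MeasurableSpace A] [BorelSpace A] {F : Type*} [NormedAddCommGroup F] [NormedSpace ℝ F]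
    (g : EuclideanSpace ℝ (Fin N) → A → F)
    (hg : Continuous fun q : EuclideanSpace ℝ (Fin N) × A => g q.1 q.2)
    (β : ℝ → Measure A) (hβ : IsRelaxedControl β) (x : EuclideanSpace ℝ (Fin N)) (s : ℝ) :
    Integrable (fun a => g x a) (β s) := by
  have := hβ.1 s
  have hc : Continuous fun a => g x a := by fun_prop
  have := hc.continuousOn.integrableOn_compact (μ := β s) (isCompact_univ (X := A))
  simpa using this

lemma aux_ii {N : ℕ} {A : Type*} [MetricSpace A] [CompactSpace A]
    [MeasurableSpace A] [BorelSpace A] {F : Type*} [NormedAddCommGroup F] [NormedSpace ℝ F]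
    (g : EuclideanSpace ℝ (Fin N) → A → F)
    (hg : Continuous fun q : EuclideanSpace ℝ (Fin N) × A => g q.1 q.2)
    (β : ℝ → Measure A) (hβ : IsRelaxedControl β)
    (y : ℝ → EuclideanSpace ℝ (Fin N)) (hy : Continuous y)
    (hm : AEStronglyMeasurable (fun s => ∫ a, g (y s) a ∂(β s)) volume) (a b : ℝ) :
    IntervalIntegrable (fun s => ∫ a, g (y s) a ∂(β s)) volume a b := by
  have hK : IsCompact ((y '' uIcc a b) ×ˢ (univ : Set A)) :=
    (isCompact_uIcc.image hy).prod isCompact_univ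
  obtain ⟨C, hC⟩ := hK.exists_bound_of_continuousOn hg.continuousOn
  refine (intervalIntegrable_const (c := C)).mono_fun hm.restrict ?_
  refine (ae_restrict_iff' measurableSet_uIoc).2 (Eventually.of_forall fun s hs => ?_)
  have := hβ.1 s
  have h1 : ‖∫ a, g (y s) a ∂(β s)‖ ≤ C * (β s).real univ :=
    norm_integral_le_of_norm_le_const (Eventually.of_forall fun a =>
      hC (y s, a) ⟨mem_image_of_mem _ (uIoc_subset_uIcc hs), mem_univ _⟩)
  simp only [probReal_univ, mul_one] at h1
  exact h1.trans (le_abs_self C)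

lemma aux_meas_vec {N : ℕ} {A : Type*} [MetricSpace A] [CompactSpace A]
    [MeasurableSpace A] [BorelSpace A]
    (f : EuclideanSpace ℝ (Fin N) → A → EuclideanSpace ℝ (Fin N))
    (hf : Continuous fun q : EuclideanSpace ℝ (Fin N) × A => f q.1 q.2)
    (β : ℝ → Measure A) (hβ : IsRelaxedControl β)
    (y : ℝ → EuclideanSpace ℝ (Fin N)) (hy : Continuous y) :
    Measurable fun s => ∫ a, f (y s) a ∂(β s) := by
  have h : ∀ i, Measurable fun s => (∫ a, f (y s) a ∂(β s)) i := by
    intro i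
    have h1 : (fun s => (∫ a, f (y s) a ∂(β s)) i) = fun s => ∫ a, f (y s) a i ∂(β s) := by
      funext s
      exact ((EuclideanSpace.proj i : EuclideanSpace ℝ (Fin N) →L[ℝ] ℝ).integral_comp_comm
        (aux_integrable f hf β hβ (y s) s)).symm
    rw [h1]
    exact aux_meas (fun x a => f x a i) (by fun_prop) β hβ y hy
  have h2 : Measurable fun s => WithLp.ofLp (∫ a, f (y s) a ∂(β s)) :=
    measurable_pi_iff.2 h
  exact (WithLp.measurable_toLp 2 _).comp h2

/-- partition argument -/
lemma aux_partition (G : ℝ → ℝ) (δ η : ℝ) (hδ : 0 ≤ δ) (hη : 0 < η)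
    (h : ∀ s t, 0 ≤ s → s ≤ t → t ≤ δ → t - s ≤ η → G s ≤ G t) : G 0 ≤ G δ := by
  obtain ⟨n, hn⟩ := exists_nat_gt (δ / η)
  have hn0 : (0:ℝ) < n := lt_of_le_of_lt (by positivity) hn
  have hstep : δ / n ≤ η := by
    rw [div_lt_iff₀ hη] at hn
    rw [div_le_iff₀ hn0]; linarith
  have hd0 : 0 ≤ δ / n := by positivity
  have key : ∀ k : ℕ, k ≤ n → G 0 ≤ G (k * (δ / n)) := by
    intro k
    induction k with
    | zero => intro _; simp
    | succ k ih =>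
      intro hk
      refine (ih (by omega)).trans (h _ _ (by positivity) ?_ ?_ ?_)
      · push_cast; nlinarith
      · have : ((k + 1 : ℕ) : ℝ) ≤ n := by exact_mod_cast hk
        calc ((k + 1 : ℕ) : ℝ) * (δ / n) ≤ n * (δ / n) := by gcongr
          _ = δ := by field_simp
      · push_cast; linarith
  have := key n le_rfl
  rwa [mul_div_cancel₀ _ hn0.ne'] at this

lemma aux_grad {N : ℕ} (c : ℝ) (x z : EuclideanSpace ℝ (Fin N)) :
    gradient (fun z' : EuclideanSpace ℝ (Fin N) => c * ‖x - z'‖ ^ 2) z = (2 * c) • (z - x) := by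
  apply HasGradientAt.gradient
  rw [hasGradientAt_iff_hasFDerivAt]
  have h1 : HasFDerivAt (fun z' : EuclideanSpace ℝ (Fin N) => x - z')
      (-(ContinuousLinearMap.id ℝ (EuclideanSpace ℝ (Fin N)))) z := by
    exact (hasFDerivAt_id (𝕜 := ℝ) z).const_sub x
  have h2 := (h1.norm_sq).const_mul c
  refine h2.congr_fderiv ?_
  refine ContinuousLinearMap.ext fun v => ?_
  simp [inner_sub_left, inner_smul_left]
  ring

lemma aux_core {N : ℕ} {A : Type*} [MetricSpace A] [CompactSpace A]
    [Nonempty A] [MeasurableSpace A] [BorelSpace A]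
    (f : EuclideanSpace ℝ (Fin N) → A → EuclideanSpace ℝ (Fin N))
    (hf : Continuous fun q : EuclideanSpace ℝ (Fin N) × A => f q.1 q.2)
    (L : ℝ) (hL : 0 < L)
    (hfLip : ∀ x y a, ‖f x a - f y a‖ ≤ L * ‖x - y‖)
    (ℓ : EuclideanSpace ℝ (Fin N) → A → ℝ)
    (hℓ : Continuous fun q : EuclideanSpace ℝ (Fin N) × A => ℓ q.1 q.2)
    (E : Set (EuclideanSpace ℝ (Fin N))) (hEb : Bornology.IsBounded E)
    (hEo : IsOpen E)
    (u : EuclideanSpace ℝ (Fin N) → ℝ) (hu : ContinuousOn u (closure E))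
    (hsol : IsViscositySol
      (fun x p => ⨆ a : A, (-(inner (𝕜 := ℝ) (f x a) p : ℝ) - ℓ x a)) E u)
    (β : ℝ → Measure A) (hβ : IsRelaxedControl β) (q : EuclideanSpace ℝ (Fin N))
    (y : ℝ → EuclideanSpace ℝ (Fin N)) (hy : IsTrajectory f β q y)
    (δ : ℝ) (hδ : 0 ≤ δ) (hE : ∀ t ∈ Icc 0 δ, y t ∈ E) (κ : ℝ) (hκ : 0 < κ) :
    u q ≤ (∫ s in (0:ℝ)..δ, ∫ a, ℓ (y s) a ∂(β s)) + u (y δ) + κ + (2 * L + 3) * κ * δ := by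
  obtain ⟨hy0, hyc, hyi⟩ := hy
  have hK : IsCompact (closure E) := hEb.isCompact_closure
  have hqE : q ∈ E := hy0 ▸ hE 0 ⟨le_rfl, hδ⟩
  have hsub : E ⊆ closure E := subset_closure
  have hφi : ∀ a b, IntervalIntegrable (fun s => ∫ a, f (y s) a ∂(β s)) volume a b :=
    aux_ii f hf β hβ y hyc (aux_meas_vec f hf β hβ y hyc).aestronglyMeasurable
  have hψi : ∀ a b, IntervalIntegrable (fun s => ∫ a, ℓ (y s) a ∂(β s)) volume a b :=
    aux_ii ℓ hℓ β hβ y hyc (aux_meas ℓ hℓ β hβ y hyc).aestronglyMeasurable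
  -- the pointwise subsolution inequality
  have hpt : ∀ (c : ℝ) (x z : EuclideanSpace ℝ (Fin N)), z ∈ E →
      (∀ z' ∈ closure E, u z' - c * ‖x - z'‖ ^ 2 ≤ u z - c * ‖x - z‖ ^ 2) →
      ∀ a, 0 ≤ (inner (𝕜 := ℝ) (f z a) ((2 * c) • (z - x)) : ℝ) + ℓ z a := by
    intro c x z hz hmax a
    have h := hsol.2 (fun z' => c * ‖x - z'‖ ^ 2)
      (contDiff_const.mul ((contDiff_const.sub contDiff_id).norm_sq ℝ)).contDiffOn z hz
      (by
        refine eventually_nhdsWithin_of_forall fun z' hz' => ?_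
        exact hmax z' (hsub hz'))
    rw [aux_grad] at h
    have hb : BddAbove (range fun a : A =>
        (-(inner (𝕜 := ℝ) (f z a) ((2 * c) • (z - x)) : ℝ) - ℓ z a)) := by
      have hcc : Continuous fun a : A =>
        (-(inner (𝕜 := ℝ) (f z a) ((2 * c) • (z - x)) : ℝ) - ℓ z a) := by fun_prop
      simpa using (isCompact_univ (X := A)).bddAbove_image hcc.continuousOn
    have h2 := (le_ciSup hb a).trans h
    linarith
  -- bounds
  obtain ⟨Mu, hMu⟩ := hK.exists_bound_of_continuousOn hu
  have hMu0 : 0 ≤ Mu := (norm_nonneg _).trans (hMu q (hsub hqE))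
  obtain ⟨M, hM⟩ := (hK.prod (isCompact_univ (X := A))).exists_bound_of_continuousOn
    hf.continuousOn
  have hM0 : 0 ≤ M := (norm_nonneg _).trans
    (hM (q, Classical.arbitrary A) ⟨hsub hqE, mem_univ _⟩)
  obtain ⟨ρ₁, hρ₁, h₁⟩ := Metric.uniformContinuousOn_iff.1
    ((hK.prod (isCompact_univ (X := A))).uniformContinuousOn_of_continuous hℓ.continuousOn) κ hκ
  obtain ⟨ρ₂, hρ₂, h₂⟩ := Metric.uniformContinuousOn_iff.1
    (hK.uniformContinuousOn_of_continuous hu) κ hκ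
  have hyK : IsCompact (y '' Icc 0 δ) := isCompact_Icc.image hyc
  obtain ⟨ρ₃, hρ₃, h₃⟩ := hyK.exists_thickening_subset_open hEo
    (by rintro _ ⟨t, ht, rfl⟩; exact hE t ht)
  obtain ⟨ρ, hρ, hρ1, hρ2, hρ3⟩ : ∃ ρ > 0, ρ ≤ ρ₁ ∧ ρ ≤ ρ₂ ∧ ρ ≤ ρ₃ :=
    ⟨min ρ₁ (min ρ₂ ρ₃), by positivity, min_le_left _ _,
      (min_le_right _ _).trans (min_le_left _ _), (min_le_right _ _).trans (min_le_right _ _)⟩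
  obtain ⟨c, hc⟩ : ∃ c, c = (2 * Mu + 1) / (ρ / 2) ^ 2 := ⟨_, rfl⟩
  have hc0 : 0 < c := by rw [hc]; positivity
  have hc1 : c * (ρ / 2) ^ 2 = 2 * Mu + 1 := by rw [hc]; field_simp
  -- Lipschitz bound on the trajectory
  have hdiff : ∀ s t, 0 ≤ s → 0 ≤ t → y t - y s = ∫ r in s..t, ∫ a, f (y r) a ∂(β r) := by
    intro s t hs ht
    rw [hyi t ht, hyi s hs, add_sub_add_left_eq_sub,
      intervalIntegral.integral_interval_sub_left (hφi _ _) (hφi _ _)]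
  have hlip : ∀ s t, 0 ≤ s → s ≤ t → t ≤ δ → ‖y t - y s‖ ≤ M * (t - s) := by
    intro s t hs hst ht
    rw [hdiff s t hs (hs.trans hst)]
    have := intervalIntegral.norm_integral_le_of_norm_le_const (a := s) (b := t) (C := M)
      (f := fun r => ∫ a, f (y r) a ∂(β r)) (by
        intro r hr
        rw [uIoc_of_le hst] at hr
        have := hβ.1 r
        have h1 : ‖∫ a, f (y r) a ∂(β r)‖ ≤ M * (β r).real univ :=
          norm_integral_le_of_norm_le_const (Eventually.of_forall fun a =>
            hM (y r, a) ⟨hsub (hE r ⟨hs.trans hr.1.le, hr.2.trans ht⟩), mem_univ _⟩)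
        simpa using h1)
    rwa [abs_of_nonneg (by linarith)] at this
  -- sup-convolution
  have hex : ∀ x, ∃ z ∈ closure E, ∀ z' ∈ closure E,
      u z' - c * ‖x - z'‖ ^ 2 ≤ u z - c * ‖x - z‖ ^ 2 := by
    intro x
    have hcont : ContinuousOn (fun z => u z - c * ‖x - z‖ ^ 2) (closure E) :=
      hu.sub (by fun_prop)
    obtain ⟨z, hz, hz'⟩ := hK.exists_isMaxOn ⟨q, hsub hqE⟩ hcont
    exact ⟨z, hz, fun z' h => hz' h⟩
  choose Z hZK hZmax using hex
  have hZ1 : ∀ t ∈ Icc 0 δ, ‖y t - Z (y t)‖ < ρ / 2 := by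
    intro t ht
    have h := hZmax (y t) (y t) (hsub (hE t ht))
    have ha := abs_le.1 (hMu (y t) (hsub (hE t ht)))
    have hb := abs_le.1 (hMu (Z (y t)) (hZK (y t)))
    simp only [sub_self, norm_zero] at h
    have h' : c * ‖y t - Z (y t)‖ ^ 2 < c * (ρ / 2) ^ 2 := by rw [hc1]; nlinarith
    have h'' := lt_of_mul_lt_mul_left h' hc0.le
    exact lt_of_pow_lt_pow_left₀ 2 (by positivity) h''
  have hZ2 : ∀ t ∈ Icc 0 δ, u (Z (y t)) - u (y t) ≤ κ := by
    intro t ht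
    have h := h₂ (Z (y t)) (hZK _) (y t) (hsub (hE t ht))
      (by rw [dist_comm, dist_eq_norm]; linarith [hZ1 t ht])
    rw [Real.dist_eq] at h
    linarith [le_abs_self (u (Z (y t)) - u (y t))]
  have hZ3 : ∀ t ∈ Icc 0 δ, c * ‖y t - Z (y t)‖ ^ 2 ≤ κ := by
    intro t ht
    have h := hZmax (y t) (y t) (hsub (hE t ht))
    simp only [sub_self, norm_zero] at h
    nlinarith [hZ2 t ht]
  have hZE : ∀ t ∈ Icc 0 δ, Z (y t) ∈ E := by
    intro t ht
    apply h₃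
    rw [Metric.mem_thickening_iff]
    exact ⟨y t, mem_image_of_mem _ ht, by
      rw [dist_comm, dist_eq_norm]; linarith [hZ1 t ht]⟩
  -- step size
  obtain ⟨η, hη, hη1, hη2, hη3⟩ : ∃ η > 0, M * η ≤ ρ / 2 ∧ L * (2 * c * ρ) * (M * η) ≤ κ ∧
      c * M ^ 2 * η ≤ κ := by
    have hev : ∀ k : ℝ, ∀ b : ℝ, 0 < b → ∀ᶠ η in 𝓝[>] (0:ℝ), k * η ≤ b := by
      intro k b hb
      have : Tendsto (fun η : ℝ => k * η) (𝓝[>] 0) (𝓝 0) := by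
        have : Tendsto (fun η : ℝ => k * η) (𝓝 0) (𝓝 (k * 0)) :=
          (continuous_const.mul continuous_id).tendsto 0
        rw [mul_zero] at this
        exact this.mono_left nhdsWithin_le_nhds
      exact (this.eventually (gt_mem_nhds hb)).mono fun _ h => le_of_lt h
    obtain ⟨η, ⟨⟨h1, h2⟩, h3⟩, h4⟩ := (((hev M (ρ / 2) (by positivity)).and
      (hev (L * (2 * c * ρ) * M) κ hκ)).and (hev (c * M ^ 2) κ hκ)).and
      self_mem_nhdsWithin |>.exists
    exact ⟨η, h4, h1, by rw [← mul_assoc]; exact h2, h3⟩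
  have hpart := aux_partition (fun t => (u (Z (y t)) - c * ‖y t - Z (y t)‖ ^ 2)
      + (∫ s in (0:ℝ)..t, ∫ a, ℓ (y s) a ∂(β s)) + (2 * L + 3) * κ * t) δ η hδ hη (by
    intro s t hs hst ht hη'
    have hsI : s ∈ Icc 0 δ := ⟨hs, hst.trans ht⟩
    set z := Z (y s) with hz
    have hg : u z - c * ‖y t - z‖ ^ 2 ≤ u (Z (y t)) - c * ‖y t - Z (y t)‖ ^ 2 :=
      hZmax (y t) z (hZK _)
    set p := (2 * c) • (z - y s) with hp
    have hpn : ‖p‖ = 2 * c * ‖y s - z‖ := by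
      rw [hp, norm_smul, norm_sub_rev, Real.norm_of_nonneg (by positivity)]
    have hexp : c * ‖y t - z‖ ^ 2 = c * ‖y s - z‖ ^ 2 + c * ‖y t - y s‖ ^ 2
        - inner ℝ p (y t - y s) := by
      have e : y t - z = (y s - z) + (y t - y s) := by abel
      rw [e, norm_add_sq_real, hp, inner_smul_left, ← neg_sub (y s) z, inner_neg_left]
      simp
      ring
    have hpt' := hpt c (y s) z (hZE s hsI) (hZmax (y s))
    have hstepM : M * (t - s) ≤ ρ / 2 := (mul_le_mul_of_nonneg_left hη' hM0).trans hη1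
    -- pointwise bound
    have hpw : ∀ r ∈ Icc s t, ∀ a, -(ℓ (y r) a) - (2 * L + 2) * κ ≤ inner ℝ p (f (y r) a) := by
      intro r hr a
      have hrI : r ∈ Icc 0 δ := ⟨hs.trans hr.1, hr.2.trans ht⟩
      have hd1 : ‖y r - y s‖ ≤ M * (t - s) :=
        (hlip s r hs hr.1 hrI.2).trans (mul_le_mul_of_nonneg_left (by linarith [hr.2]) hM0)
      have hd2 : ‖y r - z‖ ≤ ‖y s - z‖ + M * (t - s) := by
        have e : y r - z = (y r - y s) + (y s - z) := by abel
        rw [e]; linarith [norm_add_le (y r - y s) (y s - z)]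
      have hd3 : ‖y r - z‖ < ρ := by linarith [hZ1 s hsI]
      have hl := h₁ (y r, a) ⟨hsub (hE r hrI), mem_univ _⟩ (z, a) ⟨hZK _, mem_univ _⟩
        (by rw [Prod.dist_eq]; simp [dist_eq_norm]; linarith)
      rw [Real.dist_eq] at hl
      have hl' := (abs_lt.1 hl).1
      simp only at hl'
      have h0 := hpt' a
      rw [real_inner_comm] at h0
      have e : inner ℝ p (f (y r) a) = inner ℝ p (f z a) + inner ℝ p (f (y r) a - f z a) := by
        rw [← inner_add_right]; congr 1; abel
      have hin : |inner ℝ p (f (y r) a - f z a)| ≤ ‖p‖ * (L * ‖y r - z‖) :=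
        (abs_real_inner_le_norm _ _).trans
          (mul_le_mul_of_nonneg_left (hfLip _ _ _) (norm_nonneg _))
      have hbd : ‖p‖ * (L * ‖y r - z‖) ≤ 2 * L * κ + κ := by
        rw [hpn]
        have hz3 := hZ3 s hsI
        have hz1 := (hZ1 s hsI).le
        calc 2 * c * ‖y s - z‖ * (L * ‖y r - z‖)
            ≤ 2 * c * ‖y s - z‖ * (L * (‖y s - z‖ + M * (t - s))) := by gcongr
          _ = 2 * L * (c * ‖y s - z‖ ^ 2) + L * (2 * c * ‖y s - z‖) * (M * (t - s)) := by ring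
          _ ≤ 2 * L * κ + L * (2 * c * ρ) * (M * η) := by
            have : 0 ≤ t - s := by linarith
            have : ‖y s - z‖ ≤ ρ := by linarith
            gcongr
          _ ≤ 2 * L * κ + κ := by linarith
      have := (abs_le.1 (hin.trans hbd)).1
      rw [e]; linarith
    have hint : -(∫ r in s..t, ∫ a, ℓ (y r) a ∂(β r)) - (2 * L + 2) * κ * (t - s)
        ≤ inner ℝ p (y t - y s) := by
      rw [hdiff s t hs (hs.trans hst)]
      have e1 : inner ℝ p (∫ r in s..t, ∫ a, f (y r) a ∂(β r))
          = ∫ r in s..t, inner ℝ p (∫ a, f (y r) a ∂(β r)) :=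
        ((innerSL ℝ p).intervalIntegral_comp_comm (hφi s t)).symm
      have e2 : -(∫ r in s..t, ∫ a, ℓ (y r) a ∂(β r)) - (2 * L + 2) * κ * (t - s)
          = ∫ r in s..t, (-(∫ a, ℓ (y r) a ∂(β r)) - (2 * L + 2) * κ) := by
        rw [intervalIntegral.integral_sub (f := fun r => -(∫ a, ℓ (y r) a ∂(β r)))
            (hψi s t).neg intervalIntegrable_const,
          intervalIntegral.integral_neg, intervalIntegral.integral_const, smul_eq_mul]
        ring
      rw [e1, e2]
      refine intervalIntegral.integral_mono_on hst ((hψi s t).neg.sub intervalIntegrable_const)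
        ?_ ?_
      · exact ⟨(innerSL ℝ p).integrable_comp (hφi s t).1, (innerSL ℝ p).integrable_comp (hφi s t).2⟩
      · intro r hr
        have := hβ.1 r
        have hfi := aux_integrable f hf β hβ (y r) r
        have hli := aux_integrable ℓ hℓ β hβ (y r) r
        have e3 : inner ℝ p (∫ a, f (y r) a ∂(β r)) = ∫ a, inner ℝ p (f (y r) a) ∂(β r) :=
          ((innerSL ℝ p).integral_comp_comm hfi).symm
        have e4 : -(∫ a, ℓ (y r) a ∂(β r)) - (2 * L + 2) * κ
            = ∫ a, (-(ℓ (y r) a) - (2 * L + 2) * κ) ∂(β r) := by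
          rw [integral_sub (f := fun a => -(ℓ (y r) a)) hli.neg (integrable_const _), integral_neg]
          simp
        rw [e3, e4]
        exact integral_mono (hli.neg.sub (integrable_const _)) ((innerSL ℝ p).integrable_comp hfi)
          (hpw r hr)
    have hsq : c * ‖y t - y s‖ ^ 2 ≤ κ * (t - s) := by
      have hts : 0 ≤ t - s := by linarith
      calc c * ‖y t - y s‖ ^ 2 ≤ c * (M * (t - s)) ^ 2 := by
            gcongr; exact hlip s t hs hst ht
        _ = (c * M ^ 2 * (t - s)) * (t - s) := by ring
        _ ≤ (c * M ^ 2 * η) * (t - s) := by gcongr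
        _ ≤ κ * (t - s) := by gcongr
    have hadd := intervalIntegral.integral_add_adjacent_intervals (hψi 0 s) (hψi s t)
    rw [← hadd]
    nlinarith)
  simp only [intervalIntegral.integral_same, mul_zero, add_zero] at hpart
  have h0 := hZmax (y 0) (y 0) (hsub (hE 0 ⟨le_rfl, hδ⟩))
  simp only [sub_self, norm_zero] at h0
  have h1 := hZ2 δ ⟨hδ, le_rfl⟩
  have h2 : 0 ≤ c * ‖y δ - Z (y δ)‖ ^ 2 := by positivity
  rw [hy0] at h0 hpart
  linarith

lemma aux_stay {N : ℕ} (E : Set (EuclideanSpace ℝ (Fin N))) (hEo : IsOpen E)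
    (y : ℝ → EuclideanSpace ℝ (Fin N)) (hy : Continuous y) (h0 : y 0 ∈ E) (δ : ℝ)
    (h : ∀ t, 0 ≤ t → t ≤ δ → y t ∉ frontier E) : ∀ t ∈ Icc 0 δ, y t ∈ E := by
  intro t ht
  by_contra hn
  have hpre : IsPreconnected (y '' Icc 0 δ) := isPreconnected_Icc.image _ hy.continuousOn
  have hnc : ∀ s ∈ Icc 0 δ, y s ∉ E → y s ∈ (closure E)ᶜ := by
    intro s hs hs' hcl
    refine h s hs.1 hs.2 ?_
    rw [hEo.frontier_eq]
    exact ⟨hcl, hs'⟩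
  obtain ⟨w, -, hw1, hw2⟩ := hpre E (closure E)ᶜ hEo isClosed_closure.isOpen_compl
    (by
      rintro _ ⟨s, hs, rfl⟩
      by_cases hs' : y s ∈ E
      · exact Or.inl hs'
      · exact Or.inr (hnc s hs hs'))
    ⟨y 0, mem_image_of_mem _ ⟨le_rfl, ht.1.trans ht.2⟩, h0⟩
    ⟨y t, mem_image_of_mem _ ht, hnc t ht hn⟩
  exact hw2 (subset_closure hw1)

/-- the sub-optimality lemma.  If `u` is continuous on the closure of the
bounded open set `E` and a viscosity solution of `H(x,Du) = 0` on `E`, where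
`H(x,p) = sup_{a ∈ A} {−f(x,a)·p − ℓ(x,a)}`, then along any relaxed control `β`, up to
(and including, when finite) the first time the trajectory hits `∂E`,
`u(q) ≤ ∫₀^δ ℓ^r(y_q(s,β),β(s)) ds + u(y_q(δ,β))`.
(The condition `δ < τ_q(β)` is expressed by saying that `y_q(t,β) ∉ ∂E` for all
`t ∈ [0,δ]`.) -/
theorem subsolution_representation {N : ℕ} {A : Type*} [MetricSpace A] [CompactSpace A]
    [Nonempty A] [MeasurableSpace A] [BorelSpace A]
    (f : EuclideanSpace ℝ (Fin N) → A → EuclideanSpace ℝ (Fin N))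
    (hf : Continuous fun q : EuclideanSpace ℝ (Fin N) × A => f q.1 q.2)
    (L : ℝ) (hL : 0 < L)
    (hfLip : ∀ x y a, ‖f x a - f y a‖ ≤ L * ‖x - y‖)
    (ℓ : EuclideanSpace ℝ (Fin N) → A → ℝ)
    (hℓ : Continuous fun q : EuclideanSpace ℝ (Fin N) × A => ℓ q.1 q.2)
    (hℓnn : ∀ x a, 0 ≤ ℓ x a)
    (Y : EuclideanSpace ℝ (Fin N) → (ℝ → Measure A) → ℝ → EuclideanSpace ℝ (Fin N))
    (hY : ∀ x β, IsRelaxedControl β → IsTrajectory f β x (Y x β))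
    (Eset : Set (EuclideanSpace ℝ (Fin N))) (hEb : Bornology.IsBounded Eset)
    (hEo : IsOpen Eset)
    (u : EuclideanSpace ℝ (Fin N) → ℝ) (hu : ContinuousOn u (closure Eset))
    (hsol : IsViscositySol
      (fun x p => ⨆ a : A, (-(inner (𝕜 := ℝ) (f x a) p : ℝ) - ℓ x a)) Eset u) :
    ∀ β, IsRelaxedControl β → ∀ q ∈ Eset,
      (∀ δ : ℝ, 0 ≤ δ → (∀ t, 0 ≤ t → t ≤ δ → Y q β t ∉ frontier Eset) →
        u q ≤ (∫ s in (0:ℝ)..δ, ∫ a, ℓ (Y q β s) a ∂(β s)) + u (Y q β δ)) ∧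
      ((exitTimes (frontier Eset) (Y q β)).Nonempty →
        u q ≤ (∫ s in (0:ℝ)..(sInf (exitTimes (frontier Eset) (Y q β))),
                ∫ a, ℓ (Y q β s) a ∂(β s))
              + u (Y q β (sInf (exitTimes (frontier Eset) (Y q β))))) := by
  intro β hβ q hq
  obtain ⟨hy0, hyc, hyi⟩ := hY q β hβ
  have first : ∀ δ : ℝ, 0 ≤ δ → (∀ t, 0 ≤ t → t ≤ δ → Y q β t ∉ frontier Eset) →
        u q ≤ (∫ s in (0:ℝ)..δ, ∫ a, ℓ (Y q β s) a ∂(β s)) + u (Y q β δ) := by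
    intro δ hδ hfr
    have hE := aux_stay Eset hEo (Y q β) hyc (hy0.symm ▸ hq) δ hfr
    apply le_of_forall_pos_le_add
    intro e he
    have hD : 0 < 1 + (2 * L + 3) * δ := by positivity
    have h := aux_core f hf L hL hfLip ℓ hℓ Eset hEb hEo u hu hsol β hβ q (Y q β)
      (hY q β hβ) δ hδ hE (e / (1 + (2 * L + 3) * δ)) (by positivity)
    have e1 : e / (1 + (2 * L + 3) * δ) + (2 * L + 3) * (e / (1 + (2 * L + 3) * δ)) * δ = e := by
      field_simp
    linarith
  refine ⟨first, fun hne => ?_⟩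
  set τ := sInf (exitTimes (frontier Eset) (Y q β)) with hτ
  have hbdd : BddBelow (exitTimes (frontier Eset) (Y q β)) := ⟨0, fun t ht => ht.1⟩
  have hcl : IsClosed (exitTimes (frontier Eset) (Y q β)) :=
    isClosed_Ici.inter (isClosed_frontier.preimage hyc)
  have hmem : τ ∈ exitTimes (frontier Eset) (Y q β) := hcl.csInf_mem hne hbdd
  have hτ0 : 0 < τ := by
    refine lt_of_le_of_ne hmem.1 fun h => ?_
    have h2 := hmem.2
    rw [← h, hy0, hEo.frontier_eq] at h2
    exact h2.2 hq
  have hnot : ∀ t, 0 ≤ t → t < τ → Y q β t ∉ frontier Eset := fun t ht htτ hin =>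
    absurd (csInf_le hbdd ⟨ht, hin⟩) (not_le.2 htτ)
  have hψi : ∀ a b, IntervalIntegrable (fun s => ∫ a, ℓ (Y q β s) a ∂(β s)) volume a b :=
    aux_ii ℓ hℓ β hβ _ hyc (aux_meas ℓ hℓ β hβ _ hyc).aestronglyMeasurable
  have hev : ∀ᶠ t in 𝓝[<] τ, t ∈ Ioo 0 τ := Ioo_mem_nhdsLT hτ0
  have hyt : Tendsto (Y q β) (𝓝[<] τ) (𝓝[closure Eset] (Y q β τ)) := by
    refine tendsto_nhdsWithin_iff.2 ⟨hyc.continuousAt.tendsto.mono_left nhdsWithin_le_nhds, ?_⟩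
    filter_upwards [hev] with t ht
    exact subset_closure (aux_stay Eset hEo (Y q β) hyc (hy0.symm ▸ hq) t
      (fun s hs hst => hnot s hs (hst.trans_lt ht.2)) t ⟨ht.1.le, le_rfl⟩)
  have hut : Tendsto (fun t => u (Y q β t)) (𝓝[<] τ) (𝓝 (u (Y q β τ))) :=
    (hu (Y q β τ) (frontier_subset_closure hmem.2)).tendsto.comp hyt
  have hit : Tendsto (fun t => ∫ s in (0:ℝ)..t, ∫ a, ℓ (Y q β s) a ∂(β s)) (𝓝[<] τ)
      (𝓝 (∫ s in (0:ℝ)..τ, ∫ a, ℓ (Y q β s) a ∂(β s))) :=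
    ((intervalIntegral.continuous_primitive hψi 0).tendsto τ).mono_left nhdsWithin_le_nhds
  refine ge_of_tendsto (hit.add hut) ?_
  filter_upwards [hev] with t ht
  exact first t ht.1.le fun s hs hst => hnot s hs (hst.trans_lt ht.2)
end
end

section
/- Assume the relaxed-control exit-time setup (no target hypotheses needed). Let B ⊂ ℝ^N be bounded and open, and let w be continuous on the closure of B and a viscosity solution of H(x,Dw(x)) = 0 on B, where H(x,p) := sup_{a ∈ A} { −f(x,a)·p − ℓ(x,a) }. For p ∈ B and δ > 0 set T_δ(p) := inf{ t ≥ 0 : there exists α ∈ 𝒜 with dist(y_p(t,α), ∂B) ≤ δ }. Then for every p ∈ B, every δ ∈ (0, dist(p,∂B)/2], and every t ∈ (0, T_δ(p)), one has w(p) ≥ inf_{α ∈ 𝒜} { ∫₀^t ℓ^r(y_p(s,α),α(s)) ds + w(y_p(t,α)) }. -/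
open MeasureTheory Set Filter Topology Metric
open scoped RealInnerProductSpace ENNReal

noncomputable section

theorem aux_intervalIntegrable {X A F : Type*} [TopologicalSpace X] [TopologicalSpace.PseudoMetrizableSpace X]
    [MetricSpace A] [CompactSpace A]
    [MeasurableSpace A] [BorelSpace A] [NormedAddCommGroup F]
    (g : X → A → F) (hg : Continuous fun q : X × A => g q.1 q.2)
    (y : ℝ → X) (hy : Continuous y) (c : ℝ → A) (hc : Measurable c) (a b : ℝ) :
    IntervalIntegrable (fun s => g (y s) (c s)) volume a b := by
  have hm : StronglyMeasurable (fun s => g (y s) (c s)) :=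
    hg.comp_stronglyMeasurable (hy.stronglyMeasurable.prodMk hc.stronglyMeasurable)
  obtain ⟨C, hC⟩ := ((isCompact_uIcc (a := a) (b := b)).image hy |>.prod
    (isCompact_univ : IsCompact (univ : Set A))).exists_bound_of_continuousOn hg.continuousOn
  rw [intervalIntegrable_iff]
  refine IntegrableOn.of_bound (by simp) hm.aestronglyMeasurable C ?_
  refine (ae_restrict_iff' measurableSet_uIoc).2 (Eventually.of_forall fun s hs => ?_)
  exact hC (y s, c s) ⟨⟨s, uIoc_subset_uIcc hs, rfl⟩, mem_univ _⟩

theorem aux_unique {N : ℕ} {A : Type*} [MetricSpace A] [CompactSpace A]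
    [MeasurableSpace A] [BorelSpace A]
    (f : EuclideanSpace ℝ (Fin N) → A → EuclideanSpace ℝ (Fin N))
    (hf : Continuous fun q : EuclideanSpace ℝ (Fin N) × A => f q.1 q.2)
    (L : ℝ)
    (hfLip : ∀ x y a, ‖f x a - f y a‖ ≤ L * ‖x - y‖)
    (x : EuclideanSpace ℝ (Fin N))
    (y y' : ℝ → EuclideanSpace ℝ (Fin N)) (hy : Continuous y) (hy' : Continuous y')
    (c c' : ℝ → A) (hc : Measurable c) (hc' : Measurable c') (T : ℝ)
    (hcc : ∀ s, s < T → c s = c' s)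
    (h : ∀ t, 0 ≤ t → y t = x + ∫ s in (0:ℝ)..t, f (y s) (c s))
    (h' : ∀ t, 0 ≤ t → y' t = x + ∫ s in (0:ℝ)..t, f (y' s) (c' s)) :
    ∀ t, 0 ≤ t → t ≤ T → y t = y' t := by
  set u : ℝ → ℝ := fun s => ‖y s - y' s‖ with hu
  have huc : Continuous u := (hy.sub hy').norm
  have key : ∀ t, 0 ≤ t → t ≤ T → u t ≤ L * ∫ s in (0:ℝ)..t, u s := by
    intro t ht htT
    have h1 := aux_intervalIntegrable f hf y hy c hc 0 t
    have h2 := aux_intervalIntegrable f hf y' hy' c' hc' 0 t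
    have e : y t - y' t = ∫ s in (0:ℝ)..t, (f (y s) (c s) - f (y' s) (c' s)) := by
      rw [intervalIntegral.integral_sub h1 h2, h t ht, h' t ht]; abel
    rw [hu]; dsimp only
    rw [e, ← intervalIntegral.integral_const_mul]
    refine intervalIntegral.norm_integral_le_of_norm_le ht ?_
      ((continuous_const.mul huc).intervalIntegrable _ _)
    have : ∀ᵐ s : ℝ, s ≠ T := by simp [ae_iff]
    filter_upwards [this] with s hs hst
    rw [hcc s (lt_of_le_of_ne (hst.2.trans htT) hs)]
    exact hfLip _ _ _
  have hU : ∀ t, HasDerivAt (fun t => ∫ s in (0:ℝ)..t, u s) (u t) t := fun t =>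
    intervalIntegral.integral_hasDerivAt_right (huc.intervalIntegrable _ _)
      huc.aestronglyMeasurable.stronglyMeasurableAtFilter huc.continuousAt
  intro t ht htT
  have hUnn : ∀ s, 0 ≤ s → 0 ≤ ∫ r in (0:ℝ)..s, u r := fun s hs =>
    intervalIntegral.integral_nonneg hs (fun _ _ => norm_nonneg _)
  have g := norm_le_gronwallBound_of_norm_deriv_right_le (f := fun t => ∫ s in (0:ℝ)..t, u s)
    (f' := u) (δ := 0) (K := L) (ε := 0) (a := 0) (b := T)
    (fun s _ => (hU s).continuousAt.continuousWithinAt)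
    (fun s _ => (hU s).hasDerivWithinAt) (by simp)
    (fun s hs => by
      have := key s hs.1 hs.2.le
      rw [Real.norm_of_nonneg (norm_nonneg _), Real.norm_of_nonneg (hUnn s hs.1)]
      simpa using this) t ⟨ht, htT⟩
  rw [gronwallBound_ε0_δ0] at g
  have z : ∫ s in (0:ℝ)..t, u s = 0 := norm_le_zero_iff.1 g
  have := key t ht htT
  rw [z, mul_zero] at this
  exact sub_eq_zero.1 (norm_le_zero_iff.1 this)

theorem intervalIntegral_inner_aux {E : Type*} [NormedAddCommGroup E] [InnerProductSpace ℝ E]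
    [CompleteSpace E] (v : E) (g : ℝ → E) (a b : ℝ) (hg : IntervalIntegrable g volume a b) :
    ∫ r in a..b, inner ℝ v (g r) = inner ℝ v (∫ r in a..b, g r) := by
  have := (innerSL ℝ v).intervalIntegral_comp_comm hg
  simpa using this

theorem aux_visc {N : ℕ} {A : Type*} [MetricSpace A] [CompactSpace A] [Nonempty A]
    (f : EuclideanSpace ℝ (Fin N) → A → EuclideanSpace ℝ (Fin N))
    (hf : Continuous fun q : EuclideanSpace ℝ (Fin N) × A => f q.1 q.2)
    (ℓ : EuclideanSpace ℝ (Fin N) → A → ℝ)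
    (hℓ : Continuous fun q : EuclideanSpace ℝ (Fin N) × A => ℓ q.1 q.2)
    (Bset : Set (EuclideanSpace ℝ (Fin N)))
    (w : EuclideanSpace ℝ (Fin N) → ℝ)
    (hsol : IsViscositySol
      (fun x p => ⨆ a : A, (-(inner (𝕜 := ℝ) (f x a) p : ℝ) - ℓ x a)) Bset w)
    (y z : EuclideanSpace ℝ (Fin N)) (hz : z ∈ Bset) (κ : ℝ)
    (hmin : IsMinOn (fun x => w x + κ * ‖y - x‖ ^ 2) (closure Bset) z) :
    ∃ a, inner ℝ (y - z) (f z a) * (2 * κ) + ℓ z a ≤ 0 := by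
  have hgr : HasGradientAt (fun x => -(κ * ‖y - x‖ ^ 2)) ((2 * κ) • (y - z)) z := by
    rw [hasGradientAt_iff_hasFDerivAt]
    have h1 : HasFDerivAt (fun x => y - x)
        (-(ContinuousLinearMap.id ℝ (EuclideanSpace ℝ (Fin N)))) z := (hasFDerivAt_id z).const_sub y
    have h2 := ((h1.norm_sq).const_mul κ).neg
    refine HasFDerivAt.congr_fderiv h2 ?_
    ext v
    simp [mul_comm, mul_assoc]
    ring
  have h0 := hsol.1 (fun x => -(κ * ‖y - x‖ ^ 2))
    (by
      apply ContDiff.contDiffOn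
      exact (contDiff_const.mul ((contDiff_const.sub contDiff_id).norm_sq ℝ)).neg) z hz
    (by
      refine IsMinOn.localize ?_
      intro x hx
      have := hmin (subset_closure hx)
      simpa using this)
  rw [hgr.gradient] at h0
  have hc : Continuous (fun a : A => (-(inner (𝕜 := ℝ) (f z a) ((2 * κ) • (y - z)) : ℝ) - ℓ z a)) := by
    have h1 : Continuous (fun a : A => f z a) := hf.comp (by fun_prop : Continuous fun a : A => (z, a))
    have h2 : Continuous (fun a : A => ℓ z a) := hℓ.comp (by fun_prop : Continuous fun a : A => (z, a))
    fun_prop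
  obtain ⟨a, -, ha⟩ := isCompact_univ.exists_isMaxOn (univ_nonempty (α := A)) hc.continuousOn
  refine ⟨a, ?_⟩
  have h3 := h0.trans (ciSup_le fun b => ha (mem_univ b))
  simp only [inner_smul_right] at h3
  rw [real_inner_comm] at h3
  linarith

theorem aux_step {N : ℕ} {A : Type*} [MetricSpace A] [CompactSpace A]
    [MeasurableSpace A] [BorelSpace A]
    (f : EuclideanSpace ℝ (Fin N) → A → EuclideanSpace ℝ (Fin N))
    (hf : Continuous fun q : EuclideanSpace ℝ (Fin N) × A => f q.1 q.2)
    (L : ℝ) (hL : 0 < L)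
    (hfLip : ∀ x y a, ‖f x a - f y a‖ ≤ L * ‖x - y‖)
    (ℓ : EuclideanSpace ℝ (Fin N) → A → ℝ)
    (hℓ : Continuous fun q : EuclideanSpace ℝ (Fin N) × A => ℓ q.1 q.2)
    (y : ℝ → EuclideanSpace ℝ (Fin N)) (hy : Continuous y) (a : A)
    (T h K κ ε ρ : ℝ) (hh : 0 ≤ h) (hκ : 0 ≤ κ) (hK : 0 ≤ K)
    (z : EuclideanSpace ℝ (Fin N))
    (htr : ∀ r ∈ Icc T (T + h), y r = y T + ∫ s in T..r, f (y s) a)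
    (hfK : ∀ r ∈ Icc T (T + h), ‖f (y r) a‖ ≤ K)
    (ha : inner ℝ (y T - z) (f z a) * (2 * κ) + ℓ z a ≤ 0)
    (hρ : ‖y T - z‖ + K * h < ρ)
    (hle : ∀ r ∈ Icc T (T + h), ‖y r - z‖ < ρ → ℓ (y r) a ≤ ℓ z a + ε) :
    κ * ‖y (T + h) - z‖ ^ 2 + ∫ r in T..(T + h), ℓ (y r) a ≤
      κ * ‖y T - z‖ ^ 2 +
        h * (ε + 2 * κ * ‖y T - z‖ * (L * (‖y T - z‖ + K * h)) + κ * K ^ 2 * h) := by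
  have hTT : T ≤ T + h := by linarith
  set σ := ‖y T - z‖ with hσ
  have hfi : ∀ p q : ℝ, IntervalIntegrable (fun s => f (y s) a) volume p q := fun p q =>
    aux_intervalIntegrable f hf y hy (fun _ => a) measurable_const p q
  have hli : ∀ p q : ℝ, IntervalIntegrable (fun s => ℓ (y s) a) volume p q := fun p q =>
    aux_intervalIntegrable ℓ hℓ y hy (fun _ => a) measurable_const p q
  have hdist : ∀ r ∈ Icc T (T + h), ‖y r - y T‖ ≤ K * h := by
    intro r hr
    rw [htr r hr, add_sub_cancel_left]
    have := intervalIntegral.norm_integral_le_of_norm_le_const (a := T) (b := r) (C := K)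
      (f := fun s => f (y s) a) (fun s hs => by
        rw [uIoc_of_le hr.1] at hs
        exact hfK s ⟨hs.1.le, hs.2.trans hr.2⟩)
    refine this.trans ?_
    rw [abs_of_nonneg (by linarith [hr.1])]
    exact mul_le_mul_of_nonneg_left (by linarith [hr.2]) hK
  have hdz : ∀ r ∈ Icc T (T + h), ‖y r - z‖ ≤ σ + K * h := by
    intro r hr
    have e : y r - z = (y T - z) + (y r - y T) := by abel
    rw [e]
    exact (norm_add_le _ _).trans (by linarith [hdist r hr])
  have hpt : ∀ r ∈ Icc T (T + h),
      ℓ (y r) a + 2 * κ * inner ℝ (y T - z) (f (y r) a) ≤ ε + 2 * κ * σ * (L * (σ + K * h)) := by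
    intro r hr
    have h1 := hle r hr ((hdz r hr).trans_lt hρ)
    have h2 : inner ℝ (y T - z) (f (y r) a) ≤ inner ℝ (y T - z) (f z a) + σ * (L * (σ + K * h)) := by
      have e : f (y r) a = f z a + (f (y r) a - f z a) := by abel
      rw [e, inner_add_right]
      have h3 := real_inner_le_norm (y T - z) (f (y r) a - f z a)
      have h4 : ‖f (y r) a - f z a‖ ≤ L * (σ + K * h) :=
        (hfLip _ _ _).trans (mul_le_mul_of_nonneg_left (hdz r hr) hL.le)
      have h5 := mul_le_mul_of_nonneg_left h4 (norm_nonneg (y T - z))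
      linarith
    have h6 := mul_le_mul_of_nonneg_left h2 (by positivity : 0 ≤ 2 * κ)
    nlinarith
  have hint : ∫ r in T..(T + h), (ℓ (y r) a + 2 * κ * inner ℝ (y T - z) (f (y r) a)) ≤
      h * (ε + 2 * κ * σ * (L * (σ + K * h))) := by
    have hI : IntervalIntegrable (fun r => inner ℝ (y T - z) (f (y r) a)) volume T (T + h) :=
      ⟨(hfi T (T + h)).1.const_inner _, (hfi T (T + h)).2.const_inner _⟩
    have := intervalIntegral.integral_mono_on hTT ((hli _ _).add (hI.const_mul (2 * κ)))
      (intervalIntegrable_const (c := ε + 2 * κ * σ * (L * (σ + K * h)))) hpt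
    rw [intervalIntegral.integral_const, smul_eq_mul, add_sub_cancel_left] at this
    exact this
  have hinn : ∫ r in T..(T + h), inner ℝ (y T - z) (f (y r) a) =
      inner ℝ (y T - z) (y (T + h) - y T) := by
    rw [htr (T + h) ⟨hTT, le_rfl⟩, add_sub_cancel_left]
    exact intervalIntegral_inner_aux _ _ _ _ (hfi _ _)
  have hI : IntervalIntegrable (fun r => inner ℝ (y T - z) (f (y r) a)) volume T (T + h) :=
    ⟨(hfi T (T + h)).1.const_inner _, (hfi T (T + h)).2.const_inner _⟩
  rw [intervalIntegral.integral_add (hli _ _) (hI.const_mul (2 * κ)),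
    intervalIntegral.integral_const_mul, hinn] at hint
  have e : y (T + h) - z = (y T - z) + (y (T + h) - y T) := by abel
  rw [e, norm_add_sq_real]
  have h7 : ‖y (T + h) - y T‖ ^ 2 ≤ (K * h) ^ 2 :=
    pow_le_pow_left₀ (norm_nonneg _) (hdist _ ⟨hTT, le_rfl⟩) 2
  have h8 := mul_le_mul_of_nonneg_left h7 hκ
  rw [← hσ]
  nlinarith

set_option maxHeartbeats 1000000

/-- the super-optimality lemma.  If `w` is continuous on the closure of the
bounded open set `B` and a viscosity solution of `H(x,Dw) = 0` on `B`, where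
`H(x,p) = sup_{a ∈ A} {−f(x,a)·p − ℓ(x,a)}`, then for `p ∈ B`,
`δ ∈ (0, dist(p,∂B)/2]` and `0 < t < T_δ(p)`,
`w(p) ≥ inf_α { ∫₀^t ℓ^r(y_p(s,α),α(s)) ds + w(y_p(t,α)) }`.
(The condition `t < T_δ(p)` is expressed by saying that `dist(y_p(s,α), ∂B) > δ`
for every relaxed control `α` and every `s ∈ [0,t]`.) -/
theorem supersolution_representation {N : ℕ} {A : Type*} [MetricSpace A] [CompactSpace A]
    [Nonempty A] [MeasurableSpace A] [BorelSpace A]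
    (f : EuclideanSpace ℝ (Fin N) → A → EuclideanSpace ℝ (Fin N))
    (hf : Continuous fun q : EuclideanSpace ℝ (Fin N) × A => f q.1 q.2)
    (L : ℝ) (hL : 0 < L)
    (hfLip : ∀ x y a, ‖f x a - f y a‖ ≤ L * ‖x - y‖)
    (ℓ : EuclideanSpace ℝ (Fin N) → A → ℝ)
    (hℓ : Continuous fun q : EuclideanSpace ℝ (Fin N) × A => ℓ q.1 q.2)
    (hℓnn : ∀ x a, 0 ≤ ℓ x a)
    (Y : EuclideanSpace ℝ (Fin N) → (ℝ → Measure A) → ℝ → EuclideanSpace ℝ (Fin N))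
    (hY : ∀ x β, IsRelaxedControl β → IsTrajectory f β x (Y x β))
    (Bset : Set (EuclideanSpace ℝ (Fin N))) (hBb : Bornology.IsBounded Bset)
    (hBo : IsOpen Bset)
    (w : EuclideanSpace ℝ (Fin N) → ℝ) (hw : ContinuousOn w (closure Bset))
    (hsol : IsViscositySol
      (fun x p => ⨆ a : A, (-(inner (𝕜 := ℝ) (f x a) p : ℝ) - ℓ x a)) Bset w) :
    ∀ p ∈ Bset, ∀ δ : ℝ, 0 < δ → δ ≤ Metric.infDist p (frontier Bset) / 2 →
      ∀ t : ℝ, 0 < t →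
      (∀ s, 0 ≤ s → s ≤ t → ∀ α, IsRelaxedControl α →
        δ < Metric.infDist (Y p α s) (frontier Bset)) →
      sInf { c : ℝ | ∃ α, IsRelaxedControl α ∧
          c = (∫ s in (0:ℝ)..t, ∫ a, ℓ (Y p α s) a ∂(α s)) + w (Y p α t) } ≤ w p := by
  intro p hp δ hδ hδ' t ht hstay
  classical
  set D : (ℝ → A) → ℝ → Measure A := fun c s => Measure.dirac (c s) with hD
  have hDc : ∀ c : ℝ → A, Measurable c → IsRelaxedControl (D c) := by
    intro c hc
    refine ⟨fun s => by simp only [hD]; infer_instance, fun g => ?_⟩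
    simp only [hD, integral_dirac]
    exact g.continuous.measurable.comp hc
  have hcpt : IsCompact (closure Bset) := hBb.isCompact_closure
  -- trajectories stay in B
  have hinB : ∀ α, IsRelaxedControl α → ∀ s, 0 ≤ s → s ≤ t → Y p α s ∈ Bset := by
    intro α hα s hs0 hst
    obtain ⟨h0, hcont, -⟩ := hY p α hα
    have hpre : IsPreconnected (Y p α '' Icc 0 t) :=
      isPreconnected_Icc.image _ hcont.continuousOn
    have hsub : Y p α '' Icc 0 t ⊆ Bset := by
      refine hpre.subset_of_closure_inter_subset hBo ⟨p, ⟨0, ⟨le_rfl, ht.le⟩, h0⟩, hp⟩ ?_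
      rintro x ⟨hx, ⟨r, hr, rfl⟩⟩
      by_contra hxB
      have hfr : Y p α r ∈ frontier Bset := by
        rw [hBo.frontier_eq]; exact ⟨hx, hxB⟩
      have := hstay r hr.1 hr.2 α hα
      rw [infDist_zero_of_mem hfr] at this
      linarith
    exact hsub ⟨s, ⟨hs0, hst⟩, rfl⟩
  -- bounds
  obtain ⟨M, hM⟩ := hcpt.exists_bound_of_continuousOn hw
  have hM0 : 0 ≤ M := (norm_nonneg _).trans (hM p (subset_closure hp))
  obtain ⟨K0, hK0⟩ := (hcpt.prod (isCompact_univ : IsCompact (univ : Set A))).exists_bound_of_continuousOn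
    hf.continuousOn
  set K := max K0 1 with hKdef
  have hK1 : 1 ≤ K := le_max_right _ _
  have hKpos : 0 < K := by linarith
  have hfK : ∀ x ∈ closure Bset, ∀ a, ‖f x a‖ ≤ K := fun x hx a =>
    (hK0 (x, a) ⟨hx, mem_univ _⟩).trans (le_max_left _ _)
  set S := { c : ℝ | ∃ α, IsRelaxedControl α ∧
          c = (∫ s in (0:ℝ)..t, ∫ a, ℓ (Y p α s) a ∂(α s)) + w (Y p α t) } with hS
  have hSbdd : BddBelow S := by
    refine ⟨-M, ?_⟩
    rintro c ⟨α, hα, rfl⟩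
    have h1 : 0 ≤ ∫ s in (0:ℝ)..t, ∫ a, ℓ (Y p α s) a ∂(α s) :=
      intervalIntegral.integral_nonneg ht.le fun s _ => integral_nonneg fun a => hℓnn _ _
    have h2 := hM _ (subset_closure (hinB α hα t ht.le le_rfl))
    rw [Real.norm_eq_abs] at h2
    linarith [neg_abs_le (w (Y p α t))]
  -- main claim
  have main : ∀ ε : ℝ, 0 < ε → sInf S ≤ w p + ((3 + 2 * L) * t + 1) * ε := by
    intro ε hε
    obtain ⟨ρ1, hρ1, hwu⟩ := Metric.uniformContinuousOn_iff.1
      (hcpt.uniformContinuousOn_of_continuous hw) ε hε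
    obtain ⟨ρ2, hρ2, hlu⟩ := Metric.uniformContinuousOn_iff.1
      ((hcpt.prod (isCompact_univ : IsCompact (univ : Set A))).uniformContinuousOn_of_continuous
        hℓ.continuousOn) ε hε
    set ρ := min δ (min ρ1 ρ2) with hρdef
    have hρ : 0 < ρ := lt_min hδ (lt_min hρ1 hρ2)
    have hρδ : ρ ≤ δ := min_le_left _ _
    have hρρ1 : ρ ≤ ρ1 := (min_le_right _ _).trans (min_le_left _ _)
    have hρρ2 : ρ ≤ ρ2 := (min_le_right _ _).trans (min_le_right _ _)
    set κ : ℝ := (2 * M + 1) / (ρ / 2) ^ 2 with hκdef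
    have hκ : 0 < κ := by positivity
    have hκρ : κ * (ρ / 2) ^ 2 = 2 * M + 1 := by rw [hκdef]; field_simp
    -- minimizers
    have hmin : ∀ x ∈ Bset, δ < infDist x (frontier Bset) →
        ∃ z ∈ Bset, IsMinOn (fun x' => w x' + κ * ‖x - x'‖ ^ 2) (closure Bset) z ∧
          ‖x - z‖ < ρ / 2 ∧ κ * ‖x - z‖ ^ 2 ≤ ε ∧ w x ≤ w z + ε := by
      intro x hx hxd
      have hcf : ContinuousOn (fun x' => w x' + κ * ‖x - x'‖ ^ 2) (closure Bset) :=
        hw.add (Continuous.continuousOn (by fun_prop))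
      obtain ⟨z, hz, hzmin⟩ := hcpt.exists_isMinOn ⟨x, subset_closure hx⟩ hcf
      have h1 : w z + κ * ‖x - z‖ ^ 2 ≤ w x := by
        have := hzmin (subset_closure hx)
        simpa using this
      have hwx := hM x (subset_closure hx)
      have hwz := hM z hz
      rw [Real.norm_eq_abs, abs_le] at hwx hwz
      have h2 : ‖x - z‖ < ρ / 2 := by
        by_contra hcon
        push Not at hcon
        have := mul_le_mul_of_nonneg_left (pow_le_pow_left₀ (by positivity) hcon 2) hκ.le
        linarith [hwx.2, hwz.1]
      have hzB : z ∈ Bset := by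
        by_contra hzB
        have hfr : z ∈ frontier Bset := by
          rw [hBo.frontier_eq]; exact ⟨hz, hzB⟩
        have h3 := infDist_le_dist_of_mem (x := x) hfr
        rw [dist_eq_norm] at h3
        linarith
      have h4 := hwu x (subset_closure hx) z hz (by rw [dist_eq_norm]; linarith)
      rw [Real.dist_eq, abs_lt] at h4
      exact ⟨z, hzB, hzmin, h2, by linarith [h4.2], by linarith [h4.2]⟩
    -- number of steps
    obtain ⟨n, hn⟩ := exists_nat_gt (max (t * (2 * K / ρ))
      (max (t * (κ * ρ * L * K / ε)) (t * (κ * K ^ 2 / ε))))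
    have hn1 := (le_max_left _ _).trans_lt hn
    have hn2 := ((le_max_left _ _).trans (le_max_right _ _)).trans_lt hn
    have hn3 := ((le_max_right _ _).trans (le_max_right _ _)).trans_lt hn
    have hnpos : (0:ℝ) < n := lt_of_le_of_lt (by positivity) hn1
    set h := t / n with hhdef
    have hh : 0 < h := by positivity
    have hnh : n * h = t := by rw [hhdef]; field_simp
    have hh1 : K * h < ρ / 2 := by
      rw [hhdef, ← mul_div_assoc, div_lt_iff₀ hnpos]
      have : t * (2 * K / ρ) * (ρ / 2) = K * t := by field_simp
      nlinarith
    have hh2 : κ * ρ * L * K * h ≤ ε := by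
      rw [hhdef, ← mul_div_assoc, div_le_iff₀ hnpos]
      have : t * (κ * ρ * L * K / ε) * ε = κ * ρ * L * K * t := by field_simp
      nlinarith
    have hh3 : κ * K ^ 2 * h ≤ ε := by
      rw [hhdef, ← mul_div_assoc, div_le_iff₀ hnpos]
      have : t * (κ * K ^ 2 / ε) * ε = κ * K ^ 2 * t := by field_simp
      nlinarith
    have htraj : ∀ c : ℝ → A, Measurable c → Continuous (Y p (D c)) ∧
        ∀ r, 0 ≤ r → Y p (D c) r = p + ∫ s in (0:ℝ)..r, f (Y p (D c) s) (c s) := by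
      intro c hc
      obtain ⟨-, hcont, hint⟩ := hY p (D c) (hDc c hc)
      refine ⟨hcont, fun r hr => ?_⟩
      have := hint r hr
      simpa only [hD, integral_dirac] using this
    have ind : ∀ k : ℕ, k ≤ n → ∃ c : ℝ → A, Measurable c ∧ ∃ z ∈ closure Bset,
        w z + κ * ‖Y p (D c) (k * h) - z‖ ^ 2 +
          ∫ s in (0:ℝ)..(k * h), ℓ (Y p (D c) s) (c s) ≤ w p + k * h * ((3 + 2 * L) * ε) := by
      intro k
      induction k with
      | zero =>
        intro _
        refine ⟨fun _ => Classical.arbitrary A, measurable_const, p, subset_closure hp, ?_⟩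
        have h0 := (hY p _ (hDc (fun _ => Classical.arbitrary A) measurable_const)).1
        simp [h0]
      | succ k ih =>
        intro hk
        obtain ⟨c, hc, z0, hz0, hle0⟩ := ih (by omega)
        set T : ℝ := k * h with hT
        have hT0 : 0 ≤ T := by positivity
        have hTh : T + h ≤ t := by
          have : ((k + 1 : ℕ) : ℝ) ≤ n := by exact_mod_cast hk
          push_cast at this
          rw [← hnh, hT]
          nlinarith
        have hTs : ((k + 1 : ℕ) : ℝ) * h = T + h := by push_cast; rw [hT]; ring
        have hcα := hDc c hc
        obtain ⟨z, hzB, hzmin, hz1, hz2, hz3⟩ := hmin (Y p (D c) T)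
          (hinB _ hcα T hT0 (by linarith)) (hstay T hT0 (by linarith) _ hcα)
        obtain ⟨a, ha⟩ := aux_visc f hf ℓ hℓ Bset w hsol _ z hzB κ hzmin
        set c' : ℝ → A := fun s => if s < T then c s else a with hc'def
        have hc' : Measurable c' := Measurable.ite measurableSet_Iio hc measurable_const
        obtain ⟨hy, hyt⟩ := htraj c hc
        obtain ⟨hy', hyt'⟩ := htraj c' hc'
        have hcα' := hDc c' hc'
        have huniq : ∀ s, 0 ≤ s → s ≤ T → Y p (D c) s = Y p (D c') s :=
          aux_unique f hf L hfLip p _ _ hy hy' c c' hc hc' T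
            (fun s hs => by simp [hc'def, hs]) hyt hyt'
        have hYT := huniq T hT0 le_rfl
        set y' := Y p (D c') with hy'def
        have hB' : ∀ r ∈ Icc T (T + h), y' r ∈ closure Bset := fun r hr =>
          subset_closure (hinB _ hcα' r (hT0.trans hr.1) (hr.2.trans hTh))
        have hcr : ∀ r, T ≤ r → c' r = a := fun r hr => by simp [hc'def, not_lt.2 hr]
        have hstep := aux_step f hf L hL hfLip ℓ hℓ y' hy' a T h K κ ε ρ hh.le hκ.le hKpos.le z
          (by
            intro r hr
            have hi := fun p q => aux_intervalIntegrable f hf y' hy' c' hc' p q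
            rw [hyt' r (hT0.trans hr.1), hyt' T hT0, add_assoc]
            congr 1
            rw [← intervalIntegral.integral_add_adjacent_intervals (hi 0 T) (hi T r)]
            congr 1
            refine intervalIntegral.integral_congr fun s hs => ?_
            rw [uIcc_of_le hr.1] at hs
            simp only [hcr s hs.1])
          (fun r hr => hfK _ (hB' r hr) a)
          (by rw [← hYT]; exact ha)
          (by rw [← hYT]; linarith)
          (by
            intro r hr hrz
            have := hlu (y' r, a) ⟨hB' r hr, mem_univ _⟩ (z, a) ⟨subset_closure hzB, mem_univ _⟩
              (by
                rw [Prod.dist_eq, dist_self, dist_eq_norm]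
                simp only [max_lt_iff]
                exact ⟨by linarith, hρ2⟩)
            rw [Real.dist_eq, abs_lt] at this
            linarith [this.2])
        rw [← hYT] at hstep
        refine ⟨c', hc', z, subset_closure hzB, ?_⟩
        rw [hTs, ← hy'def]
        have hmz : w z + κ * ‖Y p (D c) T - z‖ ^ 2 ≤ w z0 + κ * ‖Y p (D c) T - z0‖ ^ 2 := by
          have := hzmin hz0
          simpa using this
        have hli := fun p q => aux_intervalIntegrable ℓ hℓ y' hy' c' hc' p q
        have hcost : ∫ s in (0:ℝ)..(T + h), ℓ (y' s) (c' s) =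
            (∫ s in (0:ℝ)..T, ℓ (Y p (D c) s) (c s)) + ∫ s in T..(T + h), ℓ (y' s) a := by
          rw [← intervalIntegral.integral_add_adjacent_intervals (hli 0 T) (hli T (T + h))]
          congr 1
          · refine intervalIntegral.integral_congr_ae ?_
            have : ∀ᵐ s : ℝ, s ≠ T := by simp [ae_iff]
            filter_upwards [this] with s hs hst
            rw [uIoc_of_le hT0] at hst
            have hlt : s < T := lt_of_le_of_ne hst.2 hs
            rw [huniq s hst.1.le hst.2]
            simp [hc'def, hlt]
          · refine intervalIntegral.integral_congr fun s hs => ?_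
            rw [uIcc_of_le (by linarith)] at hs
            simp only [hcr s hs.1]
        rw [hcost]
        set σ := ‖Y p (D c) T - z‖ with hσ
        have hσ0 : 0 ≤ σ := norm_nonneg _
        have herr : ε + 2 * κ * σ * (L * (σ + K * h)) + κ * K ^ 2 * h ≤ (3 + 2 * L) * ε := by
          have e1 : L * (κ * σ ^ 2) ≤ L * ε := mul_le_mul_of_nonneg_left hz2 hL.le
          have e2 : 2 * σ * (κ * L * K * h) ≤ ρ * (κ * L * K * h) :=
            mul_le_mul_of_nonneg_right (by linarith) (by positivity)
          have e3 : 2 * κ * σ * (L * (σ + K * h)) =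
              2 * (L * (κ * σ ^ 2)) + 2 * σ * (κ * L * K * h) := by ring
          have e4 : ρ * (κ * L * K * h) = κ * ρ * L * K * h := by ring
          rw [e3]
          linarith
        have herr2 := mul_le_mul_of_nonneg_left herr hh.le
        have : (T + h) * ((3 + 2 * L) * ε) = T * ((3 + 2 * L) * ε) + h * ((3 + 2 * L) * ε) := by ring
        linarith
    obtain ⟨c, hc, z0, hz0, hle⟩ := ind n le_rfl
    rw [hnh] at hle
    have hcα := hDc c hc
    obtain ⟨z, hzB, hzmin, hz1, hz2, hz3⟩ := hmin (Y p (D c) t)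
      (hinB _ hcα t ht.le le_rfl) (hstay t ht.le le_rfl _ hcα)
    have hmz : w z + κ * ‖Y p (D c) t - z‖ ^ 2 ≤ w z0 + κ * ‖Y p (D c) t - z0‖ ^ 2 := by
      have := hzmin hz0
      simpa using this
    have hpos : 0 ≤ κ * ‖Y p (D c) t - z‖ ^ 2 := by positivity
    have hmem : (∫ s in (0:ℝ)..t, ℓ (Y p (D c) s) (c s)) + w (Y p (D c) t) ∈ S := by
      refine ⟨D c, hcα, ?_⟩
      simp only [hD, integral_dirac]
    refine (csInf_le hSbdd hmem).trans ?_
    have e5 : ((3 + 2 * L) * t + 1) * ε = t * ((3 + 2 * L) * ε) + ε := by ring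
    rw [e5]
    linarith
  have hCpos : 0 < (3 + 2 * L) * t + 1 := by positivity
  refine le_of_forall_pos_le_add fun ε hε => ?_
  have := main (ε / ((3 + 2 * L) * t + 1)) (by positivity)
  rwa [mul_div_cancel₀ _ hCpos.ne'] at this
end
end
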